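/- arXiv:2111.09479 — 2 statements merged into one kernel-verified Lean document; each statement's English description precedes it below -/
import Mathlib

section
/- Let Uı be the split ıquantum group of a symmetric Kac–Moody type with distinguished parameters ς_i = −v⁻², and fix parities p̄_i ∈ Z/2Z for each i ∈ I. Then Uı has a presentation as a Q(v)-algebra with generators B_i (i ∈ I) and the ıSerre relations Σ_{n=0}^{1−c_{ij}} (−1)^n B_{i,p̄_i}^{(n)} B_j B_{i, c̄_{ij}+p̄_i}^{(1−c_{ij}−n)} = 0 for all i ≠ j, where B_{i,p̄}^{(m)} are the ıdivided powers of B_i. -/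
/-!
Formalization of statements from "ıquantum groups of split type via derived Hall algebras"
(Chen–Lu–Ruan).  We set up 1-periodic complexes, the 1-periodic derived category,
derived Hall algebras and ıHall algebras.
-/

open CategoryTheory Limits

noncomputable section

universe w w' w'' v u

section QuantumGroups

variable (K : Type) [Field K]

/-- The quantum integer `[n] = (v^n - v^{-n})/(v - v⁻¹)`. -/
def qInt (vq : K) (n : ℤ) : K := (vq ^ n - vq ^ (-n)) / (vq - vq⁻¹)

/-- The quantum factorial `[n]!`. -/
def qFact (vq : K) : ℕ → K
  | 0 => 1
  | n + 1 => qInt K vq (n + 1) * qFact vq n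

/-- The divided power `x^{(n)} = x^n / [n]!`. -/
def dividedPow {R : Type w} [Ring R] [Algebra K R] (vq : K) (x : R) (n : ℕ) : R :=
  (qFact K vq n)⁻¹ • x ^ n

/-- The quantum Serre sum `Σ_{r=0}^{1-c} (-1)^r x^{(r)} y x^{(1-c-r)}`. -/
def serreSum {R : Type w} [Ring R] [Algebra K R] (vq : K) (x y : R) (c : ℤ) : R :=
  ∑ r ∈ Finset.range ((1 - c).toNat + 1),
    ((-1 : K) ^ r) • (dividedPow K vq x r * y * dividedPow K vq x ((1 - c).toNat - r))

/-- Generators `E_i`, `F_i`, `K̃_i`, `K̃_i⁻¹`, `K̃'_i`, `K̃'_i⁻¹` of the Drinfeld double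
quantum group `Ũ`. -/
inductive DDGen (II : Type) : Type
  | E : II → DDGen II
  | F : II → DDGen II
  | K : II → DDGen II
  | Kinv : II → DDGen II
  | K' : II → DDGen II
  | K'inv : II → DDGen II

variable (II : Type) (cM : II → II → ℤ)

open Classical in
/-- The defining relations of the Drinfeld double quantum group `Ũ` associated with a
symmetric generalized Cartan matrix `cM`: the `K̃_i, K̃'_j` commute and are invertible,
`K̃_i E_j = v^{c_{ij}} E_j K̃_i`, `K̃_i F_j = v^{-c_{ij}} F_j K̃_i`,
`K̃'_i E_j = v^{-c_{ij}} E_j K̃'_i`, `K̃'_i F_j = v^{c_{ij}} F_j K̃'_i`,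
`[E_i, F_j] = δ_{ij} (K̃_i - K̃'_i)/(v - v⁻¹)`, and the quantum Serre relations. -/
inductive DDRel (vq : K) : FreeAlgebra K (DDGen II) → FreeAlgebra K (DDGen II) → Prop
  | KKcomm (i j : II) : DDRel vq
      (FreeAlgebra.ι K (DDGen.K i) * FreeAlgebra.ι K (DDGen.K j))
      (FreeAlgebra.ι K (DDGen.K j) * FreeAlgebra.ι K (DDGen.K i))
  | KK'comm (i j : II) : DDRel vq
      (FreeAlgebra.ι K (DDGen.K i) * FreeAlgebra.ι K (DDGen.K' j))
      (FreeAlgebra.ι K (DDGen.K' j) * FreeAlgebra.ι K (DDGen.K i))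
  | K'K'comm (i j : II) : DDRel vq
      (FreeAlgebra.ι K (DDGen.K' i) * FreeAlgebra.ι K (DDGen.K' j))
      (FreeAlgebra.ι K (DDGen.K' j) * FreeAlgebra.ι K (DDGen.K' i))
  | KKinv (i : II) : DDRel vq
      (FreeAlgebra.ι K (DDGen.K i) * FreeAlgebra.ι K (DDGen.Kinv i)) 1
  | KinvK (i : II) : DDRel vq
      (FreeAlgebra.ι K (DDGen.Kinv i) * FreeAlgebra.ι K (DDGen.K i)) 1
  | K'K'inv (i : II) : DDRel vq
      (FreeAlgebra.ι K (DDGen.K' i) * FreeAlgebra.ι K (DDGen.K'inv i)) 1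
  | K'invK' (i : II) : DDRel vq
      (FreeAlgebra.ι K (DDGen.K'inv i) * FreeAlgebra.ι K (DDGen.K' i)) 1
  | KE (i j : II) : DDRel vq
      (FreeAlgebra.ι K (DDGen.K i) * FreeAlgebra.ι K (DDGen.E j))
      ((vq ^ (cM i j)) • (FreeAlgebra.ι K (DDGen.E j) * FreeAlgebra.ι K (DDGen.K i)))
  | KF (i j : II) : DDRel vq
      (FreeAlgebra.ι K (DDGen.K i) * FreeAlgebra.ι K (DDGen.F j))
      ((vq ^ (-cM i j)) • (FreeAlgebra.ι K (DDGen.F j) * FreeAlgebra.ι K (DDGen.K i)))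
  | K'E (i j : II) : DDRel vq
      (FreeAlgebra.ι K (DDGen.K' i) * FreeAlgebra.ι K (DDGen.E j))
      ((vq ^ (-cM i j)) • (FreeAlgebra.ι K (DDGen.E j) * FreeAlgebra.ι K (DDGen.K' i)))
  | K'F (i j : II) : DDRel vq
      (FreeAlgebra.ι K (DDGen.K' i) * FreeAlgebra.ι K (DDGen.F j))
      ((vq ^ (cM i j)) • (FreeAlgebra.ι K (DDGen.F j) * FreeAlgebra.ι K (DDGen.K' i)))
  | EF (i j : II) : DDRel vq
      (FreeAlgebra.ι K (DDGen.E i) * FreeAlgebra.ι K (DDGen.F j) -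
        FreeAlgebra.ι K (DDGen.F j) * FreeAlgebra.ι K (DDGen.E i))
      (if i = j then ((vq - vq⁻¹)⁻¹) •
        (FreeAlgebra.ι K (DDGen.K i) - FreeAlgebra.ι K (DDGen.K' i)) else 0)
  | serreE (i j : II) (h : i ≠ j) : DDRel vq
      (serreSum K vq (FreeAlgebra.ι K (DDGen.E i)) (FreeAlgebra.ι K (DDGen.E j)) (cM i j)) 0
  | serreF (i j : II) (h : i ≠ j) : DDRel vq
      (serreSum K vq (FreeAlgebra.ι K (DDGen.F i)) (FreeAlgebra.ι K (DDGen.F j)) (cM i j)) 0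

/-- The Drinfeld double quantum group `Ũ = Ũ_v(g)`. -/
def UTilde (vq : K) := RingQuot (DDRel K II cM vq)

instance (vq : K) : Ring (UTilde K II cM vq) := inferInstanceAs (Ring (RingQuot _))
instance (vq : K) : Algebra K (UTilde K II cM vq) := inferInstanceAs (Algebra K (RingQuot _))

/-- The generator `E_i` of `Ũ`. -/
def tE (vq : K) (i : II) : UTilde K II cM vq :=
  RingQuot.mkAlgHom K _ (FreeAlgebra.ι K (DDGen.E i))
/-- The generator `F_i` of `Ũ`. -/
def tF (vq : K) (i : II) : UTilde K II cM vq :=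
  RingQuot.mkAlgHom K _ (FreeAlgebra.ι K (DDGen.F i))
/-- The generator `K̃_i` of `Ũ`. -/
def tK (vq : K) (i : II) : UTilde K II cM vq :=
  RingQuot.mkAlgHom K _ (FreeAlgebra.ι K (DDGen.K i))
/-- The generator `K̃'_i` of `Ũ`. -/
def tK' (vq : K) (i : II) : UTilde K II cM vq :=
  RingQuot.mkAlgHom K _ (FreeAlgebra.ι K (DDGen.K' i))

/-- The element `B_i = F_i + E_i K̃'_i` of `Ũ`. -/
def tB (vq : K) (i : II) : UTilde K II cM vq := tF K II cM vq i + tE K II cM vq i * tK' K II cM vq i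

/-- The element `k_i = K̃_i K̃'_i` of `Ũ`. -/
def tk (vq : K) (i : II) : UTilde K II cM vq := tK K II cM vq i * tK' K II cM vq i

/-- The universal ıquantum group `Ũı`: the subalgebra of `Ũ` generated by the elements
`B_i = F_i + E_i K̃'_i` and `k_i = K̃_i K̃'_i`. -/
def UTildeI (vq : K) : Subalgebra K (UTilde K II cM vq) :=
  Algebra.adjoin K (Set.range (tB K II cM vq) ∪ Set.range (tk K II cM vq))

/-- Generators `E_i`, `F_i`, `K_i`, `K_i⁻¹` of the quantum group `U`. -/
inductive QGen (II : Type) : Type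
  | E : II → QGen II
  | F : II → QGen II
  | K : II → QGen II
  | Kinv : II → QGen II

open Classical in
/-- The defining relations of the quantum group `U = U_v(g)`: the `K_i^{±1}` commute and are
invertible, `K_i E_j = v^{c_{ij}} E_j K_i`, `K_i F_j = v^{-c_{ij}} F_j K_i`,
`[E_i, F_j] = δ_{ij} (K_i - K_i⁻¹)/(v - v⁻¹)`, and the quantum Serre relations. -/
inductive QRel (vq : K) : FreeAlgebra K (QGen II) → FreeAlgebra K (QGen II) → Prop
  | KKcomm (i j : II) : QRel vq
      (FreeAlgebra.ι K (QGen.K i) * FreeAlgebra.ι K (QGen.K j))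
      (FreeAlgebra.ι K (QGen.K j) * FreeAlgebra.ι K (QGen.K i))
  | KKinv (i : II) : QRel vq
      (FreeAlgebra.ι K (QGen.K i) * FreeAlgebra.ι K (QGen.Kinv i)) 1
  | KinvK (i : II) : QRel vq
      (FreeAlgebra.ι K (QGen.Kinv i) * FreeAlgebra.ι K (QGen.K i)) 1
  | KE (i j : II) : QRel vq
      (FreeAlgebra.ι K (QGen.K i) * FreeAlgebra.ι K (QGen.E j))
      ((vq ^ (cM i j)) • (FreeAlgebra.ι K (QGen.E j) * FreeAlgebra.ι K (QGen.K i)))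
  | KF (i j : II) : QRel vq
      (FreeAlgebra.ι K (QGen.K i) * FreeAlgebra.ι K (QGen.F j))
      ((vq ^ (-cM i j)) • (FreeAlgebra.ι K (QGen.F j) * FreeAlgebra.ι K (QGen.K i)))
  | EF (i j : II) : QRel vq
      (FreeAlgebra.ι K (QGen.E i) * FreeAlgebra.ι K (QGen.F j) -
        FreeAlgebra.ι K (QGen.F j) * FreeAlgebra.ι K (QGen.E i))
      (if i = j then ((vq - vq⁻¹)⁻¹) •
        (FreeAlgebra.ι K (QGen.K i) - FreeAlgebra.ι K (QGen.Kinv i)) else 0)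
  | serreE (i j : II) (h : i ≠ j) : QRel vq
      (serreSum K vq (FreeAlgebra.ι K (QGen.E i)) (FreeAlgebra.ι K (QGen.E j)) (cM i j)) 0
  | serreF (i j : II) (h : i ≠ j) : QRel vq
      (serreSum K vq (FreeAlgebra.ι K (QGen.F i)) (FreeAlgebra.ι K (QGen.F j)) (cM i j)) 0

/-- The quantum group `U = U_v(g)`. -/
def UQ (vq : K) := RingQuot (QRel K II cM vq)

instance (vq : K) : Ring (UQ K II cM vq) := inferInstanceAs (Ring (RingQuot _))
instance (vq : K) : Algebra K (UQ K II cM vq) := inferInstanceAs (Algebra K (RingQuot _))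

/-- The generator `E_i` of `U`. -/
def uE (vq : K) (i : II) : UQ K II cM vq :=
  RingQuot.mkAlgHom K _ (FreeAlgebra.ι K (QGen.E i))
/-- The generator `F_i` of `U`. -/
def uF (vq : K) (i : II) : UQ K II cM vq :=
  RingQuot.mkAlgHom K _ (FreeAlgebra.ι K (QGen.F i))
/-- The generator `K_i⁻¹` of `U`. -/
def uKinv (vq : K) (i : II) : UQ K II cM vq :=
  RingQuot.mkAlgHom K _ (FreeAlgebra.ι K (QGen.Kinv i))

/-- The element `B_i = F_i + ς_i E_i K_i⁻¹` of `U`. -/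
def uB (vq : K) (ς : II → K) (i : II) : UQ K II cM vq :=
  uF K II cM vq i + ς i • (uE K II cM vq i * uKinv K II cM vq i)

/-- The ıquantum group `Uı_ς`: the subalgebra of `U` generated by the elements
`B_i = F_i + ς_i E_i K_i⁻¹`. -/
def UIota (vq : K) (ς : II → K) : Subalgebra K (UQ K II cM vq) :=
  Algebra.adjoin K (Set.range (uB K II cM vq ς))

end QuantumGroups

section IDividedPowers

variable (K : Type) [Field K]

open Classical in
/-- The ıdivided powers `B_{i,p̄}^{(m)}`:
`B_{i,1̄}^{(m)} = (1/[m]!) B_i^{m mod 2} Π_{s=1}^{⌊m/2⌋}(B_i² + v⁻¹[2s-1]²)` and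
`B_{i,0̄}^{(m)} = (1/[m]!) B_i Π_{s=1}^{⌊m/2⌋}(B_i² + v⁻¹[2s]²)` for odd `m`,
`(1/[m]!) Π_{s=1}^{⌊m/2⌋}(B_i² + v⁻¹[2s-2]²)` for even `m`. -/
def iDivPow {R : Type w} [Ring R] [Algebra K R] (vq : K) (x : R) (p : ZMod 2) (m : ℕ) : R :=
  (qFact K vq m)⁻¹ •
    ((if m % 2 = 1 then x else 1) *
      ((List.range (m / 2)).map fun s =>
        (x ^ 2 + (vq⁻¹ * (qInt K vq
          (if p = 1 then 2 * s + 1 else if m % 2 = 1 then 2 * s + 2 else 2 * s)) ^ 2) • 1)).prod)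

/-- The ıSerre sum `Σ_{n=0}^{1-c} (-1)^n B_{i,p̄}^{(n)} B_j B_{i,c̄+p̄}^{(1-c-n)}`. -/
def iSerreSum {R : Type w} [Ring R] [Algebra K R] (vq : K) (x y : R) (c : ℤ) (p : ZMod 2) : R :=
  ∑ n ∈ Finset.range ((1 - c).toNat + 1),
    ((-1 : K) ^ n) • (iDivPow K vq x p n * y * iDivPow K vq x ((c : ZMod 2) + p) ((1 - c).toNat - n))

variable (II : Type) (cM : II → II → ℤ)

/-- The ıSerre relations, on the free algebra with generators `B_i`. -/
inductive ISRel (vq : K) (pp : II → ZMod 2) : FreeAlgebra K II → FreeAlgebra K II → Prop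
  | serre (i j : II) (h : i ≠ j) : ISRel vq pp
      (iSerreSum K vq (FreeAlgebra.ι K i) (FreeAlgebra.ι K j) (cM i j) (pp i)) 0

/-- The algebra presented by generators `B_i` and the ıSerre relations. -/
def IPresented (vq : K) (pp : II → ZMod 2) := RingQuot (ISRel K II cM vq pp)

instance (vq : K) (pp : II → ZMod 2) : Ring (IPresented K II cM vq pp) :=
  inferInstanceAs (Ring (RingQuot _))
instance (vq : K) (pp : II → ZMod 2) : Algebra K (IPresented K II cM vq pp) :=
  inferInstanceAs (Algebra K (RingQuot _))

end IDividedPowers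

namespace ISerre

section Polynomial

variable {K : Type} [Field K] {A : Type*} [CommRing A] [Algebra K A]

/-- The three-term recurrence coefficient of the sequences `pSeq` and `ySeq`. -/
def beta (q ω t : K) (n : ℕ) : K := -(ω * (q ^ (2 * n + 2) - 1) * (1 - t ^ 2 * q ^ (2 * n)))

/-- Al-Salam–Chihara type polynomials in two commuting variables. -/
def pSeq (q ω t : K) (L R : A) : ℕ → A
  | 0 => 1
  | 1 => L - t • R
  | n + 2 => (L - (t * q ^ (2 * n + 2)) • R) * pSeq q ω t L R (n + 1) -
      beta q ω t n • pSeq q ω t L R n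

theorem pSeq_shift_pair (q ω t : K) (L R : A) (n : ℕ) :
    (pSeq q ω t L R (n + 2) = pSeq q ω (t * q ^ 2) L R (n + 2) +
      (t * (q ^ (2 * n + 4) - 1)) • R * pSeq q ω (t * q ^ 2) L R (n + 1) +
      (ω * t ^ 2 * (q ^ (2 * n + 4) - 1) * (q ^ (2 * n + 2) - 1)) •
        pSeq q ω (t * q ^ 2) L R n) ∧
    (pSeq q ω t L R (n + 3) = pSeq q ω (t * q ^ 2) L R (n + 3) +
      (t * (q ^ (2 * n + 6) - 1)) • R * pSeq q ω (t * q ^ 2) L R (n + 2) +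
      (ω * t ^ 2 * (q ^ (2 * n + 6) - 1) * (q ^ (2 * n + 4) - 1)) •
        pSeq q ω (t * q ^ 2) L R (n + 1)) := by
  induction n with
  | zero =>
    constructor <;>
    · simp only [pSeq, beta, Algebra.smul_def, map_mul, map_pow, map_sub, map_one, map_neg]
      ring
  | succ n ih =>
    refine ⟨ih.2, ?_⟩
    obtain ⟨h1, h2⟩ := ih
    have e (s : K) (k : ℕ) : pSeq q ω s L R (k + 2) =
      (L - (s * q ^ (2 * k + 2)) • R) * pSeq q ω s L R (k + 1) -
      beta q ω s k • pSeq q ω s L R k := rfl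
    have e4 := e (t * q ^ 2) (n + 2)
    have e3 := e (t * q ^ 2) (n + 1)
    have e2 := e (t * q ^ 2) n
    have f4 := e t (n + 2)
    simp only [add_assoc, Nat.reduceAdd] at e4 e3 e2 f4 h1 h2 ⊢
    rw [f4, h1, h2, e4, e3, e2]
    simp only [beta, Algebra.smul_def, map_mul, map_pow, map_sub, map_one, map_neg]
    ring

/-- A truncated polynomial is obtained from the one two degrees lower by multiplication with a
quadratic factor. -/
theorem pSeq_quadratic (q ω t : K) (L R : A) (m : ℕ) (ht : t * q ^ (m + 1) = 1) :
    pSeq q ω t L R (m + 2) =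
      (L ^ 2 - (t + q ^ (m + 1)) • (L * R) + R ^ 2 +
        (ω * (q ^ (m + 1) - t) ^ 2) • 1) * pSeq q ω (t * q ^ 2) L R m := by
  have ht' : algebraMap K A t * algebraMap K A q ^ (m + 1) = 1 := by
    rw [← map_pow, ← map_mul, ht, map_one]
  have e : pSeq q ω (t * q ^ 2) L R (m + 1) =
      (L - (t * q ^ (2 * m + 2)) • R) * pSeq q ω (t * q ^ 2) L R m := by
    cases m with
    | zero => simp [pSeq]
    | succ k =>
      have : beta q ω (t * q ^ 2) k = 0 := by
        have : (t * q ^ 2) ^ 2 * q ^ (2 * k) = (t * q ^ (k + 1 + 1)) ^ 2 := by ring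
        rw [beta, this, ht]; simp
      rw [pSeq, this, zero_smul, sub_zero]
      congr 3
      rw [show t * q ^ 2 * q ^ (2 * k + 2) = t * q ^ (2 * (k + 1) + 2) by ring]
  rw [(pSeq_shift_pair q ω t L R m).1, pSeq, e]
  simp only [beta, Algebra.smul_def, map_mul, map_pow, map_sub, map_one, map_neg, map_add]
  set P := pSeq q ω (t * q ^ 2) L R m
  set T := algebraMap K A t
  set Q := algebraMap K A q
  set W := algebraMap K A ω
  set Z := Q ^ (m + 1) with hZ
  have z1 : Q ^ (2 * m + 2) = Z ^ 2 := by rw [hZ]; ring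
  have z2 : Q ^ (2 * m + 4) = Z ^ 2 * Q ^ 2 := by rw [hZ]; ring
  have z3 : (T * Q ^ 2) ^ 2 * Q ^ (2 * m) = T ^ 2 * Z ^ 2 * Q ^ 2 := by rw [hZ]; ring
  rw [z1, z2, z3]
  clear_value P T Q W Z
  clear e ht z1 z2 z3 hZ
  grind
end Polynomial

section Parity

theorem natCast_add_one_eq_iff (n : ℕ) (p : ZMod 2) :
    ((n + 1 : ℕ) : ZMod 2) = p ↔ ¬ (n : ZMod 2) = p := by
  push_cast
  generalize (n : ZMod 2) = a
  revert a p; decide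

theorem natCast_eq_reflect_iff (n l : ℕ) (p : ZMod 2) :
    (l : ZMod 2) = 1 - ((n + l : ℕ) : ZMod 2) + p ↔ ¬ (n : ZMod 2) = p := by
  push_cast
  generalize (n : ZMod 2) = a
  generalize (l : ZMod 2) = b
  revert a b p; decide

end Parity

section QuantumInteger

variable {K : Type} [Field K] {q : K}

/-- `q` is nonzero and not a root of unity. -/
structure IsGeneric (q : K) : Prop where
  ne_zero : q ≠ 0
  pow_ne_one : ∀ n : ℕ, 0 < n → q ^ n ≠ 1

theorem IsGeneric.inv (hq : IsGeneric q) : IsGeneric q⁻¹ :=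
  ⟨inv_ne_zero hq.ne_zero, fun n hn h => hq.pow_ne_one n hn (by simpa using h)⟩

theorem IsGeneric.sub_inv_ne_zero (hq : IsGeneric q) : q - q⁻¹ ≠ 0 := by
  have h0 := hq.ne_zero
  have h := hq.pow_ne_one 2 (by norm_num)
  intro h'
  apply h
  field_simp at h'
  linear_combination h'

theorem IsGeneric.sq_sub_one_ne_zero (hq : IsGeneric q) : q ^ 2 - 1 ≠ 0 :=
  sub_ne_zero.2 (hq.pow_ne_one 2 (by norm_num))

theorem qInt_natCast (q : K) (n : ℕ) :
    qInt K q n = (q ^ n - (q ^ n)⁻¹) / (q - q⁻¹) := by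
  simp [qInt]

theorem qInt_natCast_add_one (q : K) (n : ℕ) :
    qInt K q (n + 1) = (q ^ (n + 1) - (q ^ (n + 1))⁻¹) / (q - q⁻¹) := by
  exact_mod_cast qInt_natCast q (n + 1)

theorem qInt_zero (q : K) : qInt K q 0 = 0 := by simp [qInt]

theorem IsGeneric.qInt_one (hq : IsGeneric q) : qInt K q 1 = 1 := by
  simp [qInt, hq.sub_inv_ne_zero]

theorem qInt_inv (q : K) (n : ℤ) : qInt K q⁻¹ n = qInt K q n := by
  simp only [qInt, inv_inv, inv_zpow', neg_neg]
  rw [← neg_div_neg_eq, neg_sub, neg_sub]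

theorem qFact_inv (q : K) (n : ℕ) : qFact K q⁻¹ n = qFact K q n := by
  induction n with
  | zero => rfl
  | succ n ih => rw [qFact, qFact, ih, qInt_inv]

theorem IsGeneric.qInt_ne_zero (hq : IsGeneric q) (n : ℕ) : qInt K q (n + 1) ≠ 0 := by
  have h0 := hq.ne_zero
  have h := hq.pow_ne_one (2 * (n + 1)) (by positivity)
  rw [qInt_natCast_add_one]
  refine div_ne_zero (fun h' => h ?_) hq.sub_inv_ne_zero
  field_simp at h'
  rw [mul_comm 2, pow_mul]
  linear_combination h'

theorem IsGeneric.qFact_ne_zero (hq : IsGeneric q) (n : ℕ) : qFact K q n ≠ 0 := by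
  induction n with
  | zero => exact one_ne_zero
  | succ n ih => exact mul_ne_zero (hq.qInt_ne_zero n) ih

theorem IsGeneric.qInt_add_sq (hq : IsGeneric q) (a b : ℕ) :
    qInt K q (a + b : ℕ) ^ 2 = qInt K q a ^ 2 + qInt K q b ^ 2 +
      (q ^ (a + b) + (q ^ (a + b))⁻¹) * qInt K q a * qInt K q b := by
  have h0 := hq.ne_zero
  have h1 := hq.sub_inv_ne_zero
  simp only [qInt_natCast, pow_add]
  generalize q - q⁻¹ = d at *
  have ha := pow_ne_zero a h0
  have hb := pow_ne_zero b h0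
  generalize q ^ a = x at *
  generalize q ^ b = y at *
  field_simp
  ring

theorem IsGeneric.qInt_mul_qInt_pred (hq : IsGeneric q) (m n l : ℕ) (h : n + l = m + 2) :
    qInt K q (m + 2 : ℕ) * qInt K q (m + 1 : ℕ) =
      qInt K q n * qInt K q (n - 1) + qInt K q l * qInt K q (l - 1) +
      (q ^ (m + 1) + (q ^ (m + 1))⁻¹) * qInt K q n * qInt K q l := by
  have h0 := hq.ne_zero
  have h1 := hq.sub_inv_ne_zero
  have e (n : ℕ) : qInt K q (n - 1) = (q ^ n / q - q / q ^ n) / (q - q⁻¹) := by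
    simp [qInt, zpow_sub₀ h0]
  have hm : q ^ (m + 1) = q ^ n * q ^ l / q := by
    rw [← pow_add, h, pow_succ q (m + 1), mul_div_cancel_right₀ _ h0]
  have hm' : q ^ (m + 2) = q ^ n * q ^ l := by
    rw [← pow_add, h]
  simp only [qInt_natCast, e, hm, hm']
  generalize q - q⁻¹ = d at *
  have ha := pow_ne_zero n h0
  have hb := pow_ne_zero l h0
  generalize q ^ n = x at *
  generalize q ^ l = y at *
  field_simp
  ring

end QuantumInteger

section IDivided

variable {K : Type} [Field K] {A : Type*} [Ring A] [Algebra K A]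

open Classical in
/-- The numerators of the ıdivided powers, with parameter `w` in place of `v⁻¹`. -/
def iSeq (q w : K) (x : A) (p : ZMod 2) : ℕ → A
  | 0 => 1
  | 1 => x
  | n + 2 => x * iSeq q w x p (n + 1) +
      (if ((n + 1 : ℕ) : ZMod 2) = p then w * qInt K q (n + 1 : ℕ) ^ 2 else 0) • iSeq q w x p n

/-- The ıdivided powers, with parameter `w` in place of `v⁻¹`. -/
def iDiv (q w : K) (x : A) (p : ZMod 2) (n : ℕ) : A := (qFact K q n)⁻¹ • iSeq q w x p n

variable {q : K}

theorem iDiv_zero (w : K) (x : A) (p : ZMod 2) : iDiv q w x p 0 = 1 := by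
  simp [iDiv, iSeq, qFact]

open Classical in
theorem IsGeneric.mul_iDiv (hq : IsGeneric q) (w : K) (x : A) (p : ZMod 2) (n : ℕ) :
    x * iDiv q w x p n = qInt K q (n + 1 : ℕ) • iDiv q w x p (n + 1) -
      (if (n : ZMod 2) = p then w * qInt K q n else 0) • iDiv q w x p (n - 1) := by
  cases n with
  | zero => simp [iDiv, iSeq, qFact, qInt_zero, hq.qInt_one]
  | succ n =>
    have h1 := hq.qInt_ne_zero n
    have h2 := hq.qInt_ne_zero (n + 1)
    have h3 := hq.qFact_ne_zero n
    simp only [iDiv, iSeq, qFact, Nat.add_sub_cancel, smul_add, mul_smul_comm, smul_smul]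
    push_cast at h2 ⊢
    have e1 : qInt K q (n + 1 + 1) * (qInt K q (n + 1 + 1) * (qInt K q (n + 1) * qFact K q n))⁻¹ =
      (qInt K q (n + 1) * qFact K q n)⁻¹ := by field_simp
    rw [e1, add_sub_assoc, left_eq_add, sub_eq_zero]
    congr 1
    split_ifs
    · field_simp
    · simp

open Classical in
theorem IsGeneric.sq_mul_iDiv (hq : IsGeneric q) (w : K) (x : A) (p : ZMod 2) (n : ℕ) :
    x * (x * iDiv q w x p n) =
      (qInt K q (n + 2 : ℕ) * qInt K q (n + 1 : ℕ)) • iDiv q w x p (n + 2) -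
      (if (n : ZMod 2) = p then w * qInt K q n ^ 2 else w * qInt K q (n + 1 : ℕ) ^ 2) •
        iDiv q w x p n := by
  have hp := natCast_add_one_eq_iff n p
  rw [hq.mul_iDiv, mul_sub, mul_smul_comm, mul_smul_comm, hq.mul_iDiv]
  by_cases h : (n : ZMod 2) = p
  · have h' := hp.not.2 (not_not.2 h)
    cases n with
    | zero =>
      simp only [zero_add] at h' ⊢
      simp only [h, h', if_true, if_false, zero_smul, sub_zero, Nat.cast_zero, qInt_zero, mul_zero,
        zero_pow, ne_eq, OfNat.ofNat_ne_zero, not_false_eq_true, smul_smul]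
      rw [mul_comm]
    | succ n =>
      have hp' := (natCast_add_one_eq_iff n p).1 h
      simp only [h, h', if_true, if_false, zero_smul, sub_zero, Nat.add_sub_cancel, smul_smul]
      rw [hq.mul_iDiv, if_neg hp', zero_smul, sub_zero, smul_smul]
      ring_nf
  · have h' := hp.2 h
    simp only [h, h', if_true, if_false, zero_smul, sub_zero, Nat.add_sub_cancel, smul_smul,
      smul_sub]
    ring_nf

end IDivided

section PairSum

variable {K : Type} [Field K] {A : Type*} [CommRing A] [Algebra K A] {q : K}

/-- The two-variable polynomial underlying the ıSerre sum. -/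
def pairSum (q w : K) (L R : A) (p p' : ZMod 2) (m : ℕ) : A :=
  ∑ x ∈ Finset.HasAntidiagonal.antidiagonal m, (-1 : K) ^ x.1 • (iDiv q w L p x.1 * iDiv q w R p' x.2)

theorem sum_antidiagonal_diag_shift {A : Type*} [AddCommMonoid A] (f g : ℕ → ℕ → A)
    (hf : ∀ l, f 0 l = 0) (hg : ∀ n, g n 0 = 0) (h : ∀ n l, f (n + 1) l = g n (l + 1)) (m : ℕ) :
    ∑ x ∈ Finset.HasAntidiagonal.antidiagonal m, f x.1 x.2 = ∑ x ∈ Finset.HasAntidiagonal.antidiagonal m, g x.1 x.2 := by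
  cases m with
  | zero => simp [hf, hg]
  | succ m =>
    rw [Finset.Nat.sum_antidiagonal_succ, Finset.Nat.sum_antidiagonal_succ']
    simp [hf, hg, h]

open Classical in
theorem IsGeneric.pairSum_quadratic (hq : IsGeneric q) (w : K) (L R : A) (p p' : ZMod 2) (m : ℕ)
    (hp : p' = 1 - (m : ZMod 2) + p) :
    (L ^ 2 - (q ^ (m + 1) + (q ^ (m + 1))⁻¹) • (L * R) + R ^ 2 +
        (w * qInt K q (m + 1 : ℕ) ^ 2) • 1) * pairSum q w L R p p' m =
      (qInt K q (m + 2 : ℕ) * qInt K q (m + 1 : ℕ)) • pairSum q w L R p p' (m + 2) := by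
  set s := q ^ (m + 1) + (q ^ (m + 1))⁻¹ with hs
  let G : ℕ → ℕ → A := fun n l => (-1 : K) ^ n • (iDiv q w L p n * iDiv q w R p' l)
  let δ : ℕ → K := fun n => if (n : ZMod 2) = p then 1 else 0
  have hδ (n : ℕ) : δ (n + 1) = 1 - δ n := by
    simp only [δ, natCast_add_one_eq_iff]
    split_ifs <;> simp_all
  have hδ' (n l : ℕ) (h : n + l = m) : ((l : ZMod 2) = p' ↔ ¬ (n : ZMod 2) = p) := by
    rw [hp, ← h]
    exact natCast_eq_reflect_iff n l p
  have hG : ∀ x ∈ Finset.HasAntidiagonal.antidiagonal m,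
      (L ^ 2 - s • (L * R) + R ^ 2 + (w * qInt K q (m + 1 : ℕ) ^ 2) • 1) * G x.1 x.2 =
      (qInt K q (x.1 + 2 : ℕ) * qInt K q (x.1 + 1 : ℕ)) • G (x.1 + 2) x.2 +
      (qInt K q (x.2 + 2 : ℕ) * qInt K q (x.2 + 1 : ℕ)) • G x.1 (x.2 + 2) +
      (s * qInt K q (x.1 + 1 : ℕ) * qInt K q (x.2 + 1 : ℕ)) • G (x.1 + 1) (x.2 + 1) +
      (s * w * (δ (x.1 + 1) * qInt K q (x.1 + 1 : ℕ) * qInt K q x.2 +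
        (1 - δ (x.1 + 1)) * qInt K q (x.2 + 1 : ℕ) * qInt K q x.1)) • G x.1 x.2 -
      (s * w * (δ x.1 * qInt K q x.1 * qInt K q (x.2 + 1 : ℕ))) • G (x.1 - 1) (x.2 + 1) -
      (s * w * ((1 - δ x.1) * qInt K q x.2 * qInt K q (x.1 + 1 : ℕ))) •
        G (x.1 + 1) (x.2 - 1) := by
    rintro ⟨n, l⟩ hx
    rw [Finset.HasAntidiagonal.mem_antidiagonal] at hx
    simp only at hx ⊢
    have hL := hq.mul_iDiv w L p n
    have hLL := hq.sq_mul_iDiv w L p n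
    have hR := hq.mul_iDiv w R p' l
    have hRR := hq.sq_mul_iDiv w R p' l
    simp only [hδ' n l hx] at hR hRR
    have key1 := hq.qInt_add_sq (n + 1) l
    have key2 := hq.qInt_add_sq n (l + 1)
    rw [show n + 1 + l = m + 1 by omega] at key1
    rw [show n + (l + 1) = m + 1 by omega] at key2
    rw [← hs] at key1 key2
    have e : (L ^ 2 - s • (L * R) + R ^ 2 + (w * qInt K q (m + 1 : ℕ) ^ 2) • 1) * G n l =
        (-1 : K) ^ n • ((L * (L * iDiv q w L p n)) * iDiv q w R p' l
          - s • ((L * iDiv q w L p n) * (R * iDiv q w R p' l))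
          + (R * (R * iDiv q w R p' l)) * iDiv q w L p n
          + (w * qInt K q (m + 1 : ℕ) ^ 2) • (iDiv q w L p n * iDiv q w R p' l)) := by
      simp only [G, Algebra.smul_def]
      ring
    rw [e, hLL, hL, hRR, hR, hδ]
    by_cases h : (n : ZMod 2) = p
    · simp only [δ, h, not_true, if_true, if_false, key2, G, Algebra.smul_def, map_mul, map_pow,
        map_sub, map_add, map_one, map_zero, map_neg]
      have hsign : algebraMap K A (qInt K q n) * ((-1) ^ (n - 1) + (-1) ^ n) = 0 := by
        cases n with
        | zero => simp [qInt_zero]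
        | succ n => rw [Nat.add_sub_cancel]; ring
      linear_combination (algebraMap K A w * algebraMap K A s * algebraMap K A
        (qInt K q (l + 1 : ℕ)) * iDiv q w L p (n - 1) * iDiv q w R p' (l + 1)) * hsign
    · simp only [δ, h, not_false_eq_true, if_true, if_false, key1, G, Algebra.smul_def, map_mul,
        map_pow, map_sub, map_add, map_one, map_zero, map_neg]
      ring
  have s1 : ∑ x ∈ Finset.HasAntidiagonal.antidiagonal m,
        (s * w * (δ x.1 * qInt K q x.1 * qInt K q (x.2 + 1 : ℕ))) • G (x.1 - 1) (x.2 + 1) =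
      ∑ x ∈ Finset.HasAntidiagonal.antidiagonal m,
        (s * w * (δ (x.1 + 1) * qInt K q (x.1 + 1 : ℕ) * qInt K q x.2)) • G x.1 x.2 :=
    sum_antidiagonal_diag_shift
      (fun n l => (s * w * (δ n * qInt K q n * qInt K q (l + 1 : ℕ))) • G (n - 1) (l + 1))
      (fun n l => (s * w * (δ (n + 1) * qInt K q (n + 1 : ℕ) * qInt K q l)) • G n l)
      (by simp [qInt_zero]) (by simp [qInt_zero]) (fun n l => rfl) m
  have s2 : ∑ x ∈ Finset.HasAntidiagonal.antidiagonal m,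
        (s * w * ((1 - δ (x.1 + 1)) * qInt K q (x.2 + 1 : ℕ) * qInt K q x.1)) • G x.1 x.2 =
      ∑ x ∈ Finset.HasAntidiagonal.antidiagonal m,
        (s * w * ((1 - δ x.1) * qInt K q x.2 * qInt K q (x.1 + 1 : ℕ))) •
          G (x.1 + 1) (x.2 - 1) :=
    sum_antidiagonal_diag_shift
      (fun n l => (s * w * ((1 - δ (n + 1)) * qInt K q (l + 1 : ℕ) * qInt K q n)) • G n l)
      (fun n l => (s * w * ((1 - δ n) * qInt K q l * qInt K q (n + 1 : ℕ))) • G (n + 1) (l - 1))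
      (by simp [qInt_zero]) (by simp [qInt_zero])
      (fun n l => by simp only [hδ, Nat.add_sub_cancel]; ring_nf) m
  have top : (qInt K q (m + 2 : ℕ) * qInt K q (m + 1 : ℕ)) • pairSum q w L R p p' (m + 2) =
      ∑ x ∈ Finset.HasAntidiagonal.antidiagonal m,
        ((qInt K q (x.1 + 2 : ℕ) * qInt K q (x.1 + 1 : ℕ)) • G (x.1 + 2) x.2 +
        (qInt K q (x.2 + 2 : ℕ) * qInt K q (x.2 + 1 : ℕ)) • G x.1 (x.2 + 2) +
        (s * qInt K q (x.1 + 1 : ℕ) * qInt K q (x.2 + 1 : ℕ)) • G (x.1 + 1) (x.2 + 1)) := by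
    have : (qInt K q (m + 2 : ℕ) * qInt K q (m + 1 : ℕ)) • pairSum q w L R p p' (m + 2) =
        ∑ x ∈ Finset.HasAntidiagonal.antidiagonal (m + 2),
          ((qInt K q x.1 * qInt K q (x.1 - 1)) • G x.1 x.2 +
          (qInt K q x.2 * qInt K q (x.2 - 1)) • G x.1 x.2 +
          (s * qInt K q x.1 * qInt K q x.2) • G x.1 x.2) := by
      rw [pairSum, Finset.smul_sum]
      refine Finset.sum_congr rfl fun x hx => ?_
      rw [hq.qInt_mul_qInt_pred m x.1 x.2 (Finset.HasAntidiagonal.mem_antidiagonal.1 hx), add_smul, add_smul]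
    rw [this]
    simp only [Finset.sum_add_distrib]
    refine congrArg₂ (· + ·) (congrArg₂ (· + ·) ?_ ?_) ?_
    · simp [Finset.Nat.sum_antidiagonal_succ, qInt_zero, add_assoc]
    · simp [Finset.Nat.sum_antidiagonal_succ', qInt_zero, add_assoc]
    · rw [Finset.Nat.sum_antidiagonal_succ, Finset.Nat.sum_antidiagonal_succ']
      simp [qInt_zero]
  rw [top, pairSum, Finset.mul_sum, Finset.sum_congr rfl hG]
  simp only [Finset.sum_add_distrib, Finset.sum_sub_distrib, mul_add, add_smul]
  rw [s1, s2]
  abel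

/-- The closed form of the polynomials `pSeq` at truncation. -/
theorem IsGeneric.pSeq_eq_pairSum (hq : IsGeneric q) (w : K) (L R : A) (p : ZMod 2) (m : ℕ) :
    pSeq q (w * q ^ 2 / (q ^ 2 - 1) ^ 2) (q ^ (1 - m : ℤ)) L R m =
      ((-1) ^ m * qFact K q m) • pairSum q w L R p (1 - (m : ZMod 2) + p) m := by
  have h0 := hq.ne_zero
  have h1 := hq.sq_sub_one_ne_zero
  have h2 := hq.sub_inv_ne_zero
  induction m using Nat.twoStepInduction with
  | zero => simp [pSeq, pairSum, qFact, iDiv_zero]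
  | one =>
    simp [pSeq, pairSum, qFact, Finset.Nat.antidiagonal_succ, iDiv, iSeq, hq.qInt_one, sub_eq_neg_add]
  | more m ih _ =>
    have ht : q ^ (1 - (m + 2 : ℕ) : ℤ) = (q ^ (m + 1))⁻¹ := by
      rw [← zpow_natCast, ← zpow_neg]
      exact congrArg (q ^ ·) (by push_cast; ring)
    have hp : (1 : ZMod 2) - (m + 2 : ℕ) + p = 1 - m + p := by
      rw [Nat.cast_add, Nat.cast_ofNat, show (2 : ZMod 2) = 0 from rfl, add_zero]
    have ht' : q ^ (1 - (m + 2 : ℕ) : ℤ) * q ^ 2 = q ^ (1 - m : ℤ) := by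
      rw [← zpow_natCast q 2, ← zpow_add₀ h0]; congr 1; push_cast; ring
    rw [pSeq_quadratic _ _ _ _ _ _ (by rw [ht]; exact inv_mul_cancel₀ (pow_ne_zero _ h0)), ht', ih,
      ht, hp, mul_smul_comm]
    have hw : w * q ^ 2 / (q ^ 2 - 1) ^ 2 * (q ^ (m + 1) - (q ^ (m + 1))⁻¹) ^ 2 =
        w * qInt K q (m + 1 : ℕ) ^ 2 := by
      rw [qInt_natCast]
      have : q - q⁻¹ = (q ^ 2 - 1) / q := by field_simp
      rw [this]
      field_simp
    rw [hw, add_comm (q ^ (m + 1))⁻¹, hq.pairSum_quadratic w L R p _ m rfl, smul_smul]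
    congr 1
    simp only [qFact]
    push_cast
    rw [show (m : ℤ) + 1 + 1 = m + 2 by ring]
    ring

end PairSum

section Transfer

variable {K : Type} [Field K] {A B : Type*} [Ring A] [Algebra K A] [Ring B] [Algebra K B]

theorem map_iSeq (f : A →ₐ[K] B) (q w : K) (x : A) (p : ZMod 2) (n : ℕ) :
    f (iSeq q w x p n) = iSeq q w (f x) p n := by
  induction n using Nat.twoStepInduction with
  | zero => simp [iSeq]
  | one => simp [iSeq]
  | more n ih1 ih2 => simp only [iSeq, map_add, map_mul, map_smul, ih1, ih2]

theorem map_iDiv (f : A →ₐ[K] B) (q w : K) (x : A) (p : ZMod 2) (n : ℕ) :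
    f (iDiv q w x p n) = iDiv q w (f x) p n := by
  simp only [iDiv, map_smul, map_iSeq]

theorem commute_iSeq (q w : K) (x : A) (p : ZMod 2) (n : ℕ) : Commute x (iSeq q w x p n) := by
  induction n using Nat.twoStepInduction with
  | zero => exact Commute.one_right x
  | one => exact Commute.refl x
  | more n ih1 ih2 => exact ((Commute.refl x).mul_right ih2).add_right (ih1.smul_right _)

theorem mulRight_iDiv (q w : K) (x : A) (p : ZMod 2) (n : ℕ) :
    LinearMap.mulRight K (iDiv q w x p n) = iDiv q w (LinearMap.mulRight K x) p n := by
  have h : LinearMap.mulRight K (iSeq q w x p n) = iSeq q w (LinearMap.mulRight K x) p n := by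
    induction n using Nat.twoStepInduction with
    | zero => ext; simp [iSeq]
    | one => rfl
    | more n ih1 ih2 =>
      simp only [iSeq, ← ih1, ← ih2, (commute_iSeq q w x p (n + 1)).eq]
      split_ifs <;> ext z <;> simp [mul_add, mul_assoc]
  rw [iDiv, iDiv, ← h]
  ext z
  simp

/-- The ıSerre sum, with parameter `w` in place of `v⁻¹`. -/
def bimodSum (q w : K) (x y : A) (p p' : ZMod 2) (m : ℕ) : A :=
  ∑ i ∈ Finset.HasAntidiagonal.antidiagonal m,
    (-1 : K) ^ i.1 • (iDiv q w x p i.1 * y * iDiv q w x p' i.2)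

theorem map_bimodSum (f : A →ₐ[K] B) (q w : K) (x y : A) (p p' : ZMod 2) (m : ℕ) :
    f (bimodSum q w x y p p' m) = bimodSum q w (f x) (f y) p p' m := by
  simp only [bimodSum, map_sum, map_smul, map_mul, map_iDiv]

/-- The sequence `pSeq` with the two variables acting by left and right multiplication. -/
def ySeq (q ω t : K) (x y : A) : ℕ → A
  | 0 => y
  | 1 => x * y - t • (y * x)
  | n + 2 => x * ySeq q ω t x y (n + 1) -
      (t * q ^ (2 * n + 2)) • (ySeq q ω t x y (n + 1) * x) - beta q ω t n • ySeq q ω t x y n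

theorem IsGeneric.ySeq_eq_bimodSum {q : K} (hq : IsGeneric q) (w : K) (x y : A) (p : ZMod 2)
    (m : ℕ) :
    ySeq q (w * q ^ 2 / (q ^ 2 - 1) ^ 2) (q ^ (1 - m : ℤ)) x y m =
      ((-1) ^ m * qFact K q m) • bimodSum q w x y p (1 - (m : ZMod 2) + p) m := by
  let φ : TensorProduct K (Polynomial K) (Polynomial K) →ₐ[K] Module.End K A :=
    Algebra.TensorProduct.lift (Polynomial.aeval (LinearMap.mulLeft K x))
      (Polynomial.aeval (LinearMap.mulRight K x)) (fun f g => by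
        have h : Commute (LinearMap.mulLeft K x) (LinearMap.mulRight K x) :=
          LinearMap.ext fun z => (mul_assoc x z x).symm
        have h1 : Commute (Polynomial.aeval (LinearMap.mulLeft K x) f) (LinearMap.mulRight K x) := by
          induction f using Polynomial.induction_on' with
          | add a b ha hb => rw [map_add]; exact ha.add_left hb
          | monomial n a =>
            rw [Polynomial.aeval_monomial]
            exact (Algebra.commute_algebraMap_left a _).mul_left (h.pow_left n)
        induction g using Polynomial.induction_on' with
        | add a b ha hb => rw [map_add]; exact ha.add_right hb
        | monomial n a =>
          rw [Polynomial.aeval_monomial]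
          exact (Algebra.commute_algebraMap_right a _).mul_right (h1.pow_right n))
  let L : TensorProduct K (Polynomial K) (Polynomial K) := Polynomial.X ⊗ₜ 1
  let R : TensorProduct K (Polynomial K) (Polynomial K) := 1 ⊗ₜ Polynomial.X
  have hL : φ L = LinearMap.mulLeft K x := by simp [φ, L]
  have hR : φ R = LinearMap.mulRight K x := by simp [φ, R]
  have hy (ω t : K) (n : ℕ) : φ (pSeq q ω t L R n) y = ySeq q ω t x y n := by
    induction n using Nat.twoStepInduction with
    | zero => simp [pSeq, ySeq]
    | one => simp [pSeq, ySeq, hL, hR]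
    | more n ih1 ih2 =>
      simp only [pSeq, ySeq, map_sub, map_mul, map_smul, hL, hR, LinearMap.sub_apply,
        Module.End.mul_apply, LinearMap.smul_apply, ih1, ih2, LinearMap.mulLeft_apply,
        LinearMap.mulRight_apply]
  rw [← hy, hq.pSeq_eq_pairSum w L R p m]
  simp only [pairSum, bimodSum, map_smul, map_sum, map_mul, map_iDiv, hL, hR,
    LinearMap.smul_apply, LinearMap.sum_apply, Module.End.mul_apply, ← mulRight_iDiv]
  congr 1
  refine Finset.sum_congr rfl fun i _ => ?_
  have : iDiv q w (LinearMap.mulLeft K x) p i.1 = LinearMap.mulLeft K (iDiv q w x p i.1) :=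
    (map_iDiv (Algebra.lmul K A) q w x p i.1).symm
  rw [this]
  simp [mul_assoc]

theorem bimodSum_inv (q w : K) (x y : A) (p p' : ZMod 2) (m : ℕ) :
    bimodSum q⁻¹ w x y p p' m = bimodSum q w x y p p' m := by
  have h (x : A) (p : ZMod 2) (n : ℕ) : iSeq q⁻¹ w x p n = iSeq q w x p n := by
    induction n using Nat.twoStepInduction with
    | zero => rfl
    | one => rfl
    | more n ih1 ih2 => simp only [iSeq, ih1, ih2, qInt_inv]
  simp only [bimodSum, iDiv, h, qFact_inv]

end Transfer

section Ladder

variable {K : Type} [Field K] {A : Type*} [Ring A] [Algebra K A]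

theorem ySeq_zero_succ (q t : K) (x y : A) (n : ℕ) :
    ySeq q 0 t x y (n + 1) =
      x * ySeq q 0 t x y n - (t * q ^ (2 * n)) • (ySeq q 0 t x y n * x) := by
  cases n with
  | zero => simp [ySeq]
  | succ n => simp [ySeq, beta, mul_add]

variable {q ω t : K} {a b k y : A}

/-- If `k` commutes with `a` and `y` up to scalars, it commutes with `ySeq` up to a scalar. -/
theorem mul_ySeq_of_mul (c d : K) (hka : k * a = c • (a * k)) (hky : k * y = d • (y * k)) (n : ℕ) :
    k * ySeq q 0 t a y n = (d * c ^ n) • (ySeq q 0 t a y n * k) := by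
  induction n with
  | zero => simpa [ySeq] using hky
  | succ n ih =>
    have e1 : k * (a * ySeq q 0 t a y n) = (c * (d * c ^ n)) • (a * ySeq q 0 t a y n * k) := by
      rw [← mul_assoc, hka, smul_mul_assoc, mul_assoc, ih, mul_smul_comm, smul_smul, mul_assoc]
    have e2 : k * (ySeq q 0 t a y n * a) = (c * (d * c ^ n)) • (ySeq q 0 t a y n * a * k) := by
      rw [← mul_assoc, ih, smul_mul_assoc, mul_assoc, hka, mul_smul_comm, smul_smul, ← mul_assoc _ a k,
        mul_comm _ c]
    rw [ySeq_zero_succ, mul_sub, mul_smul_comm, e1, e2, sub_mul, smul_mul_assoc]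
    module

theorem mul_ySeq_succ (hba : b * a = q ^ 2 • (a * b) - (ω * (q ^ 2 - 1)) • (1 - k))
    (hka : k * a = q ^ 4 • (a * k)) (hky : k * y = t ^ 2 • (y * k)) (hby : b * y = t • (y * b))
    (n : ℕ) :
    b * ySeq q 0 t a y (n + 1) = (t * q ^ (2 * n + 2)) • (ySeq q 0 t a y (n + 1) * b) +
      beta q ω t n • ySeq q 0 t a y n := by
  have step (s : K) (Y Z : A) (hY : b * Y = s • (Y * b) + Z) (hk : k * Y = s ^ 2 • (Y * k)) :
      b * (a * Y - s • (Y * a)) = (s * q ^ 2) • ((a * Y - s • (Y * a)) * b) +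
        (q ^ 2 • (a * Z) - s • (Z * a)) - (ω * (q ^ 2 - 1) * (1 - s ^ 2)) • Y := by
    have e1 : b * (a * Y) = (q ^ 2 * s) • (a * Y * b) + q ^ 2 • (a * Z) -
        (ω * (q ^ 2 - 1)) • (Y - s ^ 2 • (Y * k)) := by
      rw [← mul_assoc, hba, sub_mul, smul_mul_assoc, smul_mul_assoc, mul_assoc, hY, sub_mul,
        one_mul, hk, mul_add, mul_smul_comm, mul_assoc]
      module
    have e2 : b * (Y * a) = (s * q ^ 2) • (Y * a * b) -
        (s * (ω * (q ^ 2 - 1))) • (Y - Y * k) + Z * a := by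
      rw [← mul_assoc, hY, add_mul, smul_mul_assoc, mul_assoc, hba, mul_sub Y, mul_smul_comm,
        mul_smul_comm, mul_sub Y, mul_one Y, ← mul_assoc Y a b]
      module
    rw [mul_sub, mul_smul_comm, e1, e2, sub_mul, smul_mul_assoc]
    module
  have hk (n : ℕ) : k * ySeq q 0 t a y n = (t * q ^ (2 * n)) ^ 2 • (ySeq q 0 t a y n * k) := by
    rw [mul_ySeq_of_mul _ _ hka hky]
    congr 1
    ring
  induction n with
  | zero =>
    have := step t y 0 (by simpa using hby) hky
    simp only [ySeq, this, beta]
    simp only [mul_zero, zero_mul, smul_zero]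
    module
  | succ n ih =>
    have h := step (t * q ^ (2 * n + 2)) _ _ ih (hk (n + 1))
    have e := ySeq_zero_succ q t a y (n + 1)
    rw [show 2 * (n + 1) = 2 * n + 2 by ring] at e
    rw [e, h, ← e]
    have e' : q ^ 2 • (a * ySeq q 0 t a y n) - (t * q ^ (2 * n + 2)) • (ySeq q 0 t a y n * a) =
        q ^ 2 • ySeq q 0 t a y (n + 1) := by
      rw [ySeq_zero_succ]
      module
    rw [mul_smul_comm, smul_mul_assoc]
    linear_combination (norm := skip) (beta q ω t n) • e'
    simp only [beta]
    module

/-- Adding to `a` an element `b` with a `q`-commutator relation deforms the recurrence. -/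
theorem ySeq_add (hba : b * a = q ^ 2 • (a * b) - (ω * (q ^ 2 - 1)) • (1 - k))
    (hka : k * a = q ^ 4 • (a * k)) (hky : k * y = t ^ 2 • (y * k)) (hby : b * y = t • (y * b))
    (n : ℕ) : ySeq q ω t (a + b) y n = ySeq q 0 t a y n := by
  induction n using Nat.twoStepInduction with
  | zero => rfl
  | one => simp [ySeq, add_mul, mul_add, hby]
  | more n ih1 ih2 =>
    rw [ySeq, ih1, ih2, add_mul, mul_add, mul_ySeq_succ hba hka hky hby n, ySeq_zero_succ _ _ _ _ (n + 1)]
    rw [show 2 * (n + 1) = 2 * n + 2 by ring]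
    module

/-- A commutator with `ySeq` that vanishes at truncation. -/
theorem commute_ySeq {κ κ' : A} (hab : a * b = b * a) (hy : b * y - y * b = κ - κ')
    (hκ : a * κ = t • (κ * a)) {m : ℕ} (hκ' : a * κ' = (t * q ^ (2 * m)) • (κ' * a)) :
    Commute b (ySeq q 0 t a y (m + 1)) := by
  have main (n : ℕ) : b * ySeq q 0 t a y (n + 1) - ySeq q 0 t a y (n + 1) * b =
      ySeq q 0 t a (-κ') (n + 1) := by
    induction n with
    | zero =>
      simp only [ySeq]
      have e1 : b * (a * y) = a * (b * y) := by rw [← mul_assoc, ← hab, mul_assoc]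
      have e2 : y * a * b = y * b * a := by rw [mul_assoc, hab, mul_assoc]
      have e3 : b * y = y * b + κ - κ' := by linear_combination (norm := module) hy
      rw [mul_sub, sub_mul, mul_smul_comm, smul_mul_assoc, e1, e2, ← mul_assoc b y a, e3]
      simp only [mul_sub, mul_add, add_mul, sub_mul, hκ, mul_assoc, smul_neg, mul_neg, neg_mul]
      module
    | succ n ih =>
      rw [ySeq_zero_succ, ySeq_zero_succ _ _ _ (-κ'), ← ih]
      generalize ySeq q 0 t a y (n + 1) = Y
      have e1 : b * (a * Y) = a * (b * Y) := by rw [← mul_assoc, ← hab, mul_assoc]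
      have e2 : Y * a * b = Y * b * a := by rw [mul_assoc, hab, mul_assoc]
      rw [mul_sub, sub_mul, mul_smul_comm, smul_mul_assoc, e1, e2]
      simp only [mul_sub, sub_mul, mul_assoc]
      module
  have comm (n : ℕ) : a * ySeq q 0 t a (-κ') n = (t * q ^ (2 * m)) • (ySeq q 0 t a (-κ') n * a) := by
    have := mul_ySeq_of_mul (q := q) (t := t) (k := a) (a := a) (y := -κ') 1 (t * q ^ (2 * m))
      (by simp) (by simp [hκ']) n
    simpa using this
  have := main m
  rw [ySeq_zero_succ _ _ _ (-κ'), comm, sub_self, sub_eq_zero] at this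
  exact this

end Ladder

section Comparison

variable {K : Type} [Field K] {A : Type w} [Ring A] [Algebra K A]

theorem iSeq_eq_prod {A : Type} [CommRing A] [Algebra K A] (q w : K) (x : A) (k : ℕ) :
    (iSeq q w x 1 (2 * k) =
        ((List.range k).map fun s => x ^ 2 + (w * qInt K q (2 * s + 1 : ℕ) ^ 2) • 1).prod ∧
      iSeq q w x 1 (2 * k + 1) =
        x * ((List.range k).map fun s => x ^ 2 + (w * qInt K q (2 * s + 1 : ℕ) ^ 2) • 1).prod) ∧
    (iSeq q w x 0 (2 * k) =
        ((List.range k).map fun s => x ^ 2 + (w * qInt K q (2 * s : ℕ) ^ 2) • 1).prod ∧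
      iSeq q w x 0 (2 * k + 1) =
        x * ((List.range k).map fun s => x ^ 2 + (w * qInt K q (2 * s + 2 : ℕ) ^ 2) • 1).prod) := by
  have h2 : (2 : ZMod 2) = 0 := rfl
  induction k with
  | zero => simp [iSeq]
  | succ k ih =>
    obtain ⟨⟨h1, h1'⟩, h0, h0'⟩ := ih
    have e (p : ZMod 2) : iSeq q w x p (2 * (k + 1)) = x * iSeq q w x p (2 * k + 1) +
      (if ((2 * k + 1 : ℕ) : ZMod 2) = p then w * qInt K q (2 * k + 1 : ℕ) ^ 2 else 0) •
        iSeq q w x p (2 * k) := rfl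
    have e' (p : ZMod 2) : iSeq q w x p (2 * (k + 1) + 1) = x * iSeq q w x p (2 * (k + 1)) +
      (if ((2 * k + 2 : ℕ) : ZMod 2) = p then w * qInt K q (2 * k + 2 : ℕ) ^ 2 else 0) •
        iSeq q w x p (2 * k + 1) := rfl
    have c1 : ((2 * k + 1 : ℕ) : ZMod 2) = 1 := by push_cast; rw [h2]; simp
    have c0 : ((2 * k + 2 : ℕ) : ZMod 2) = 0 := by push_cast; rw [h2]; simp
    have A1 : iSeq q w x 1 (2 * (k + 1)) = ((List.range (k + 1)).map fun s =>
        x ^ 2 + (w * qInt K q (2 * s + 1 : ℕ) ^ 2) • 1).prod := by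
      rw [e, h1, h1', List.prod_range_succ, c1, if_pos rfl]
      simp only [Algebra.smul_def]
      ring
    have A0 : iSeq q w x 0 (2 * (k + 1)) = ((List.range (k + 1)).map fun s =>
        x ^ 2 + (w * qInt K q (2 * s : ℕ) ^ 2) • 1).prod := by
      rw [e, h0', List.prod_range_succ', c1, if_neg (by decide)]
      simp only [Nat.succ_eq_add_one, mul_add, mul_zero, mul_one, Nat.cast_zero, qInt_zero]
      simp
      ring
    refine ⟨⟨A1, ?_⟩, A0, ?_⟩
    · rw [e', A1, c0, if_neg (by decide), zero_smul, add_zero]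
    · rw [e', c0, if_pos rfl, h0', e, c1, if_neg (by decide), zero_smul, add_zero, h0',
        List.prod_range_succ]
      simp only [Algebra.smul_def]
      ring

theorem iDivPow_eq_iDiv (q : K) (x : A) (p : ZMod 2) (n : ℕ) :
    iDivPow K q x p n = iDiv q q⁻¹ x p n := by
  have key : iDivPow K q (Polynomial.X : Polynomial K) p n = iDiv q q⁻¹ Polynomial.X p n := by
    rw [iDivPow, iDiv]
    congr 1
    obtain ⟨⟨h1, h1'⟩, h0, h0'⟩ := iSeq_eq_prod q q⁻¹ (Polynomial.X : Polynomial K) (n / 2)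
    have hp : p = 1 ∨ p = 0 := by revert p; decide
    rcases Nat.mod_two_eq_zero_or_one n with hn | hn
    · have e : n = 2 * (n / 2) := by omega
      rcases hp with rfl | rfl
      · rw [← e] at h1
        simp [h1, hn, ← List.map_eq_flatMap, Function.comp_def]
      · rw [← e] at h0
        simp [h0, hn, ← List.map_eq_flatMap, Function.comp_def]
    · have e : n = 2 * (n / 2) + 1 := by omega
      rcases hp with rfl | rfl
      · rw [← e] at h1'
        simp [h1', hn, ← List.map_eq_flatMap, Function.comp_def]
      · rw [← e] at h0'
        simp [h0', hn, ← List.map_eq_flatMap, Function.comp_def]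
  have h := congrArg (Polynomial.aeval x) key
  rw [map_iDiv, Polynomial.aeval_X] at h
  rw [← h, iDivPow, iDivPow, map_smul, map_mul, map_list_prod, List.map_map]
  congr 2
  · split_ifs <;> simp
  · congr 2
    ext s
    simp

theorem sum_range_eq_antidiagonal (f : ℕ → ℕ → A) (m : ℕ) :
    ∑ n ∈ Finset.range (m + 1), f n (m - n) =
      ∑ i ∈ Finset.HasAntidiagonal.antidiagonal m, f i.1 i.2 :=
  (Finset.Nat.sum_antidiagonal_eq_sum_range_succ f m).symm

theorem iSerreSum_eq_bimodSum (q : K) (x y : A) (p : ZMod 2) (m : ℕ) :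
    iSerreSum K q x y (1 - m) p = bimodSum q q⁻¹ x y p (1 - (m : ZMod 2) + p) m := by
  simp only [iSerreSum, bimodSum, iDivPow_eq_iDiv, sub_sub_cancel, Int.toNat_natCast]
  rw [sum_range_eq_antidiagonal fun n l => (-1 : K) ^ n •
    (iDiv q q⁻¹ x p n * y * iDiv q q⁻¹ x (((1 - m : ℤ) : ZMod 2) + p) l)]
  push_cast
  rfl

theorem iSeq_zero_eq_pow (q : K) (x : A) (p : ZMod 2) (n : ℕ) : iSeq q 0 x p n = x ^ n := by
  induction n using Nat.twoStepInduction with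
  | zero => simp [iSeq]
  | one => simp [iSeq]
  | more n ih1 ih2 => simp [iSeq, ih2, pow_succ']

theorem serreSum_eq_bimodSum (q : K) (x y : A) (p p' : ZMod 2) (m : ℕ) :
    serreSum K q x y (1 - m) = bimodSum q 0 x y p p' m := by
  simp only [serreSum, bimodSum, iDiv, iSeq_zero_eq_pow, sub_sub_cancel, Int.toNat_natCast]
  exact sum_range_eq_antidiagonal (fun n l => (-1 : K) ^ n •
    (dividedPow K q x n * y * dividedPow K q x l)) m

variable {q : K}

theorem IsGeneric.ySeq_eq_serreSum (hq : IsGeneric q) (x y : A) (m : ℕ) :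
    ySeq q 0 (q ^ (1 - m : ℤ)) x y m = ((-1) ^ m * qFact K q m) • serreSum K q x y (1 - m) := by
  have := hq.ySeq_eq_bimodSum 0 x y 0 m
  rwa [zero_mul, zero_div, ← serreSum_eq_bimodSum] at this

theorem IsGeneric.ySeq_inv_eq_serreSum (hq : IsGeneric q) (x y : A) (m : ℕ) :
    ySeq q⁻¹ 0 (q⁻¹ ^ (1 - m : ℤ)) x y m =
      ((-1) ^ m * qFact K q m) • serreSum K q x y (1 - m) := by
  have := hq.inv.ySeq_eq_bimodSum 0 x y 0 m
  rwa [zero_mul, zero_div, bimodSum_inv, ← serreSum_eq_bimodSum, qFact_inv] at this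

theorem IsGeneric.ySeq_eq_iSerreSum (hq : IsGeneric q) (x y : A) (p : ZMod 2) (m : ℕ) :
    ySeq q (q⁻¹ * q ^ 2 / (q ^ 2 - 1) ^ 2) (q ^ (1 - m : ℤ)) x y m =
      ((-1) ^ m * qFact K q m) • iSerreSum K q x y (1 - m) p := by
  rw [hq.ySeq_eq_bimodSum q⁻¹ x y p m, iSerreSum_eq_bimodSum]

theorem IsGeneric.ySeq_inv_eq_iSerreSum (hq : IsGeneric q) (x y : A) (p : ZMod 2) (m : ℕ) :
    ySeq q⁻¹ (q⁻¹ * q⁻¹ ^ 2 / (q⁻¹ ^ 2 - 1) ^ 2) (q⁻¹ ^ (1 - m : ℤ)) x y m =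
      ((-1) ^ m * qFact K q m) • iSerreSum K q x y (1 - m) p := by
  rw [hq.inv.ySeq_eq_bimodSum q⁻¹ x y p m, iSerreSum_eq_bimodSum, bimodSum_inv, qFact_inv]

theorem IsGeneric.sign_mul_qFact_ne_zero (hq : IsGeneric q) (m : ℕ) :
    (-1) ^ m * qFact K q m ≠ 0 :=
  mul_ne_zero (pow_ne_zero _ (neg_ne_zero.2 one_ne_zero)) (hq.qFact_ne_zero m)

end Comparison

/-- Elements of an algebra satisfying all the defining relations of a quantum group except the
Serre relations. -/
structure QuantumData (K : Type) [Field K] {II : Type} (cM : II → II → ℤ) (q : K) (A : Type*)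
    [Ring A] [Algebra K A] where
  E : II → A
  F : II → A
  k : II → A
  kinv : II → A
  k_comm : ∀ i j, k i * k j = k j * k i
  k_kinv : ∀ i, k i * kinv i = 1
  kinv_k : ∀ i, kinv i * k i = 1
  k_E : ∀ i j, k i * E j = q ^ cM i j • (E j * k i)
  k_F : ∀ i j, k i * F j = q ^ (-cM i j) • (F j * k i)
  E_F_self : ∀ i, E i * F i - F i * E i = (q - q⁻¹)⁻¹ • (k i - kinv i)
  E_F : ∀ i j, i ≠ j → E i * F j = F j * E i

namespace QuantumData

variable {K : Type} [Field K] {II : Type} {cM : II → II → ℤ} {q : K} {A : Type*}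
    [Ring A] [Algebra K A] (D : QuantumData K cM q A)

theorem inv_mul_of_mul {k kinv x : A} {c : K} (hc : c ≠ 0) (h1 : k * kinv = 1) (h2 : kinv * k = 1)
    (h : k * x = c • (x * k)) : kinv * x = c⁻¹ • (x * kinv) := by
  have : kinv * (k * x) * kinv = c • (kinv * x) := by
    rw [h, mul_smul_comm, smul_mul_assoc, mul_assoc, mul_assoc, h1, mul_one]
  rw [← mul_assoc, h2, one_mul] at this
  rw [this, smul_smul, inv_mul_cancel₀ hc, one_smul]

theorem kinv_comm (i j : II) : D.kinv i * D.kinv j = D.kinv j * D.kinv i := by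
  have h : D.kinv i * D.k j = D.k j * D.kinv i := by
    simpa using inv_mul_of_mul one_ne_zero (D.k_kinv i) (D.kinv_k i)
      ((D.k_comm i j).trans (one_smul K _).symm)
  have := inv_mul_of_mul (one_ne_zero (α := K)) (D.k_kinv j) (D.kinv_k j)
    (h.symm.trans (one_smul K _).symm)
  simpa using this.symm

/-- The element `-q⁻² E_i K_i⁻¹`. -/
def E' (i : II) : A := -q ^ (-2 : ℤ) • (D.E i * D.kinv i)

theorem kinv_E (hq : IsGeneric q) (i j : II) : D.kinv i * D.E j = q ^ (-cM i j) • (D.E j * D.kinv i) := by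
  rw [zpow_neg]
  exact inv_mul_of_mul (zpow_ne_zero _ hq.ne_zero) (D.k_kinv i) (D.kinv_k i) (D.k_E i j)

theorem kinv_F (hq : IsGeneric q) (i j : II) : D.kinv i * D.F j = q ^ cM i j • (D.F j * D.kinv i) := by
  have := inv_mul_of_mul (zpow_ne_zero _ hq.ne_zero) (D.k_kinv i) (D.kinv_k i) (D.k_F i j)
  rwa [zpow_neg, inv_inv] at this

/-- The Chevalley involution. -/
def swap (hq : IsGeneric q) : QuantumData K cM q A where
  E := D.F
  F := D.E
  k := D.kinv
  kinv := D.k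
  k_comm := D.kinv_comm
  k_kinv := D.kinv_k
  kinv_k := D.k_kinv
  k_E := D.kinv_F hq
  k_F := D.kinv_E hq
  E_F_self i := by rw [← neg_sub, D.E_F_self, ← smul_neg, neg_sub]
  E_F i j h := (D.E_F j i h.symm).symm

variable (hq : IsGeneric q)
include hq

omit hq in
theorem kinv_sq_mul {x : A} {i : II} {c : ℤ} (h : D.kinv i * x = q ^ c • (x * D.kinv i)) :
    (D.kinv i * D.kinv i) * x = (q ^ c) ^ 2 • (x * (D.kinv i * D.kinv i)) := by
  rw [mul_assoc, h, mul_smul_comm, ← mul_assoc, h, smul_mul_assoc, smul_smul, mul_assoc, sq]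

variable {i j : II} (hi : cM i i = 2)
include hi

theorem E'_mul_F : D.E' i * D.F i = q ^ 2 • (D.F i * D.E' i) -
    (q⁻¹ * q ^ 2 / (q ^ 2 - 1) ^ 2 * (q ^ 2 - 1)) • (1 - D.kinv i * D.kinv i) := by
  have h0 := hq.ne_zero
  have h1 := hq.sq_sub_one_ne_zero
  have e : D.E i * D.F i = D.F i * D.E i + (q - q⁻¹)⁻¹ • (D.k i - D.kinv i) := by
    rw [← D.E_F_self]; abel
  have e' : q⁻¹ * q ^ 2 / (q ^ 2 - 1) ^ 2 * (q ^ 2 - 1) = (q - q⁻¹)⁻¹ := by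
    rw [show q - q⁻¹ = (q ^ 2 - 1) / q by field_simp]
    field_simp
  have e2 : q ^ 2 * -q ^ (-2 : ℤ) = -1 := by
    rw [zpow_neg]; field_simp
  have e3 : (-q ^ (-2 : ℤ)) * q ^ (2 : ℤ) = -1 := by
    rw [zpow_neg]; field_simp
  rw [e', E', smul_mul_assoc, mul_assoc, D.kinv_F hq, hi, mul_smul_comm, ← mul_assoc, e, smul_smul,
    e3, mul_smul_comm, smul_smul, e2, add_mul, smul_mul_assoc, sub_mul, D.k_kinv, mul_assoc]
  module

theorem F_mul_E' : D.F i * D.E' i = q⁻¹ ^ 2 • (D.E' i * D.F i) -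
    (q⁻¹ * q⁻¹ ^ 2 / (q⁻¹ ^ 2 - 1) ^ 2 * (q⁻¹ ^ 2 - 1)) • (1 - D.kinv i * D.kinv i) := by
  have h0 := hq.ne_zero
  have h1 := hq.sq_sub_one_ne_zero
  have h2 := hq.inv.sq_sub_one_ne_zero
  have h3 : 1 - q ^ 2 ≠ 0 := by rw [← neg_sub]; exact neg_ne_zero.2 h1
  rw [D.E'_mul_F hq hi, smul_sub, smul_smul, smul_smul]
  have e1 : q⁻¹ ^ 2 * q ^ 2 = 1 := by field_simp
  have e2 : q⁻¹ * q⁻¹ ^ 2 / (q⁻¹ ^ 2 - 1) ^ 2 * (q⁻¹ ^ 2 - 1) =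
      -(q⁻¹ ^ 2 * (q⁻¹ * q ^ 2 / (q ^ 2 - 1) ^ 2 * (q ^ 2 - 1))) := by
    rw [show q⁻¹ ^ 2 - 1 = -(q ^ 2 - 1) / q ^ 2 by field_simp; ring]
    field_simp
  rw [e1, e2]
  module

theorem kinv_sq_F : (D.kinv i * D.kinv i) * D.F i =
    q ^ 4 • (D.F i * (D.kinv i * D.kinv i)) := by
  rw [D.kinv_sq_mul (D.kinv_F hq i i), hi]
  congr 1
  rw [zpow_ofNat]; ring

theorem kinv_E' : D.kinv i * D.E' i = q⁻¹ ^ 2 • (D.E' i * D.kinv i) := by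
  rw [E', mul_smul_comm, ← mul_assoc, D.kinv_E hq, hi, smul_mul_assoc, smul_mul_assoc, smul_comm]
  congr 1
  rw [zpow_neg, inv_pow, zpow_ofNat]

theorem kinv_sq_E' : (D.kinv i * D.kinv i) * D.E' i =
    q⁻¹ ^ 4 • (D.E' i * (D.kinv i * D.kinv i)) := by
  have := D.kinv_E' hq hi
  rw [← zpow_natCast, inv_zpow', ] at this
  rw [D.kinv_sq_mul this]
  congr 1
  rw [← inv_zpow', zpow_natCast]; ring

omit hi
variable (hij : i ≠ j)
include hij

theorem E'_F_of_ne : D.E' i * D.F j = q ^ cM i j • (D.F j * D.E' i) := by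
  rw [E', smul_mul_assoc, mul_assoc, D.kinv_F hq, mul_smul_comm, ← mul_assoc, D.E_F i j hij,
    mul_smul_comm, smul_comm, mul_assoc]

theorem F_Ekinv (hsym : cM j i = cM i j) : D.F i * (D.E j * D.kinv j) =
    q⁻¹ ^ cM i j • ((D.E j * D.kinv j) * D.F i) := by
  have h0 := zpow_ne_zero (cM i j) hq.ne_zero
  rw [mul_assoc, D.kinv_F hq, mul_smul_comm, smul_smul, ← mul_assoc (D.E j), D.E_F j i hij.symm,
    hsym, inv_zpow, inv_mul_cancel₀ h0, one_smul, mul_assoc]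

omit hij in
theorem kinv_Ekinv : D.kinv i * (D.E j * D.kinv j) =
    q⁻¹ ^ cM i j • ((D.E j * D.kinv j) * D.kinv i) := by
  rw [← mul_assoc, D.kinv_E hq, smul_mul_assoc, mul_assoc, D.kinv_comm, inv_zpow', mul_assoc]

theorem ySeq_F_add_E' (n : ℕ) (hi : cM i i = 2) :
    ySeq q (q⁻¹ * q ^ 2 / (q ^ 2 - 1) ^ 2) (q ^ cM i j) (D.F i + D.E' i) (D.F j) n =
      ySeq q 0 (q ^ cM i j) (D.F i) (D.F j) n :=
  ySeq_add (D.E'_mul_F hq hi) (D.kinv_sq_F hq hi) (D.kinv_sq_mul (D.kinv_F hq i j))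
    (D.E'_F_of_ne hq hij) n

theorem ySeq_inv_F_add_E' (n : ℕ) (hi : cM i i = 2) (hsym : cM j i = cM i j) :
    ySeq q⁻¹ (q⁻¹ * q⁻¹ ^ 2 / (q⁻¹ ^ 2 - 1) ^ 2) (q⁻¹ ^ cM i j) (D.F i + D.E' i)
        (D.E j * D.kinv j) n =
      ySeq q⁻¹ 0 (q⁻¹ ^ cM i j) (D.E' i) (D.E j * D.kinv j) n := by
  rw [add_comm]
  refine ySeq_add (k := D.kinv i * D.kinv i) (D.F_mul_E' hq hi) (D.kinv_sq_E' hq hi) ?_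
    (D.F_Ekinv hq hij hsym) n
  have := D.kinv_Ekinv hq (i := i) (j := j)
  rw [inv_zpow'] at this ⊢
  exact D.kinv_sq_mul this

omit hij in
theorem exists_ySeq_E'_eq (hsym : cM j i = cM i j) (n : ℕ) : ∃ κ : K,
    ySeq q⁻¹ 0 (q⁻¹ ^ cM i j) (D.E' i) (D.E j * D.kinv j) n =
      κ • (ySeq q⁻¹ 0 (q⁻¹ ^ cM i j) (D.E i) (D.E j) n * (D.kinv i ^ n * D.kinv j)) := by
  have h0 := hq.ne_zero
  have hk (n : ℕ) := mul_ySeq_of_mul (q := q⁻¹) (t := q⁻¹ ^ cM i j) _ _ (D.kinv_E hq i i)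
    (D.kinv_E hq i j) n
  have hkE (n : ℕ) : D.kinv i ^ n * D.E i = (q ^ (-cM i i)) ^ n • (D.E i * D.kinv i ^ n) := by
    induction n with
    | zero => simp
    | succ n ih =>
      rw [pow_succ, mul_assoc, D.kinv_E hq, mul_smul_comm, ← mul_assoc, ih, smul_mul_assoc,
        smul_smul, mul_assoc, pow_succ (q ^ _), mul_comm (q ^ (-cM i i))]
  have hkj (n : ℕ) : Commute (D.kinv i ^ n) (D.kinv j) := Commute.pow_left (D.kinv_comm i j) n
  induction n with
  | zero => exact ⟨1, by simp [ySeq]⟩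
  | succ n ih =>
    obtain ⟨κ, h⟩ := ih
    refine ⟨-q ^ (-2 : ℤ) * κ * (q ^ (-cM i j) * (q ^ (-cM i i)) ^ n), ?_⟩
    rw [ySeq_zero_succ, ySeq_zero_succ, h, E']
    specialize hk n
    specialize hkE n
    generalize ySeq q⁻¹ 0 (q⁻¹ ^ cM i j) (D.E i) (D.E j) n = Y at *
    have e1 : D.E i * D.kinv i * (Y * (D.kinv i ^ n * D.kinv j)) =
        (q ^ (-cM i j) * (q ^ (-cM i i)) ^ n) •
          (D.E i * Y * (D.kinv i ^ (n + 1) * D.kinv j)) := by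
      rw [mul_assoc, ← mul_assoc (D.kinv i), hk, smul_mul_assoc, mul_smul_comm, pow_succ']
      simp only [mul_assoc]
    have e2 : Y * (D.kinv i ^ n * D.kinv j) * (D.E i * D.kinv i) =
        (q ^ (-cM i j) * (q ^ (-cM i i)) ^ n) •
          (Y * D.E i * (D.kinv i ^ (n + 1) * D.kinv j)) := by
      have : D.kinv i ^ n * D.kinv j * (D.E i * D.kinv i) =
          (q ^ (-cM i j) * (q ^ (-cM i i)) ^ n) •
            (D.E i * (D.kinv i ^ (n + 1) * D.kinv j)) := by
        rw [mul_assoc, ← mul_assoc (D.kinv j), D.kinv_E hq, hsym, smul_mul_assoc, mul_smul_comm,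
          mul_assoc, ← mul_assoc (_ ^ n), hkE, smul_mul_assoc, smul_smul, D.kinv_comm j, pow_succ]
        simp only [mul_assoc]
      rw [mul_assoc, this, mul_smul_comm, mul_assoc]
    simp only [smul_mul_assoc, mul_smul_comm, e1, e2, sub_mul]
    module

/-- The Serre relations for the `E_i` and `F_i` imply the ıSerre relations. -/
theorem iSerreSum_eq_zero (hi : cM i i = 2) (hsym : cM j i = cM i j) (hc : cM i j ≤ 0)
    (hE : serreSum K q (D.E i) (D.E j) (cM i j) = 0)
    (hF : serreSum K q (D.F i) (D.F j) (cM i j) = 0) (p : ZMod 2) :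
    iSerreSum K q (D.F i + D.E' i) (D.F j + D.E' j) (cM i j) p = 0 := by
  obtain ⟨m, hm⟩ : ∃ m : ℕ, cM i j = 1 - m := ⟨(1 - cM i j).toNat, by omega⟩
  have e1 := D.ySeq_F_add_E' hq hij m hi
  have e2 := D.ySeq_inv_F_add_E' hq hij m hi hsym
  obtain ⟨κ, e3⟩ := D.exists_ySeq_E'_eq hq hsym m
  rw [e3] at e2
  rw [hm] at e1 e2 hE hF ⊢
  rw [hq.ySeq_eq_serreSum, hF, hq.ySeq_eq_iSerreSum _ _ p, smul_zero, smul_eq_zero,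
    or_iff_right (hq.sign_mul_qFact_ne_zero m)] at e1
  rw [hq.ySeq_inv_eq_serreSum, hE, hq.ySeq_inv_eq_iSerreSum _ _ p, smul_zero, zero_mul, smul_zero,
    smul_eq_zero, or_iff_right (hq.sign_mul_qFact_ne_zero m)] at e2
  rw [iSerreSum_eq_bimodSum] at e1 e2 ⊢
  simp only [bimodSum] at e1 e2 ⊢
  simp only [E', mul_add, add_mul, Finset.sum_add_distrib, smul_add, mul_smul_comm,
    smul_mul_assoc] at e1 e2 ⊢
  rw [e1, zero_add]
  simp only [smul_comm _ (-q ^ (-2 : ℤ)), ← Finset.smul_sum]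
  rw [e2, smul_zero]

/-- The Serre element built from the `F_i` commutes with the `E_l`. -/
theorem commute_E_serreSum (hi : cM i i = 2) (hsym : cM j i = cM i j) (hc : cM i j ≤ 0) (l : II) :
    Commute (D.E l) (serreSum K q (D.F i) (D.F j) (cM i j)) := by
  obtain ⟨m, hm⟩ : ∃ m : ℕ, cM i j = 1 - (m + 1 : ℕ) := ⟨(-cM i j).toNat, by omega⟩
  have h0 := hq.ne_zero
  suffices h : Commute (D.E l) (ySeq q 0 (q ^ cM i j) (D.F i) (D.F j) (m + 1)) by
    rw [hm, hq.ySeq_eq_serreSum] at h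
    rw [hm]
    have := h.smul_right ((-1) ^ (m + 1) * qFact K q (m + 1))⁻¹
    rwa [smul_smul, inv_mul_cancel₀ (hq.sign_mul_qFact_ne_zero _), one_smul] at this
  have hz : q ^ cM i j = (q ^ m)⁻¹ := by
    rw [hm, ← zpow_natCast, ← zpow_neg]; congr 1; push_cast; ring
  by_cases hli : l = i
  · subst hli
    have hpow : (q ^ m)⁻¹ * q ^ (2 * m + 2) = q ^ (m + 2) := by
      field_simp; ring
    have hb := mul_ySeq_succ (D.E'_mul_F hq hi) (D.kinv_sq_F hq hi)
      (D.kinv_sq_mul (D.kinv_F hq l j)) (D.E'_F_of_ne hq hij) m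
    have hβ : beta q (q⁻¹ * q ^ 2 / (q ^ 2 - 1) ^ 2) (q ^ cM l j) m = 0 := by
      rw [beta, hz]
      have : ((q ^ m)⁻¹) ^ 2 * q ^ (2 * m) = 1 := by field_simp; ring
      rw [this]; simp
    have hk := mul_ySeq_of_mul (q := q) (t := q ^ cM l j) _ _ (D.k_F l l) (D.k_F l j) (m + 1)
    rw [hβ, zero_smul, add_zero, hz, hpow] at hb
    rw [hi, zpow_neg, zpow_neg, hz, inv_inv] at hk
    rw [hz]
    generalize ySeq q 0 (q ^ m)⁻¹ (D.F l) (D.F j) (m + 1) = Y at *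
    have e : D.E l = -(q ^ 2 • (D.E' l * D.k l)) := by
      rw [E', smul_mul_assoc, mul_assoc, D.kinv_k, mul_one, smul_smul, zpow_neg, ← zpow_natCast q 2]
      simp [h0]
    rw [Commute, SemiconjBy, e, neg_mul, mul_neg, smul_mul_assoc, mul_smul_comm, mul_assoc, hk,
      mul_smul_comm, ← mul_assoc, hb, smul_mul_assoc, smul_smul, smul_smul, mul_assoc Y]
    congr 2
    rw [zpow_ofNat, inv_pow, ← pow_mul]
    field_simp
    ring
  by_cases hlj : l = j
  · subst hlj
    refine commute_ySeq (κ := (q - q⁻¹)⁻¹ • D.k l) (κ' := (q - q⁻¹)⁻¹ • D.kinv l)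
      (D.E_F l i hli).symm ?_ ?_ ?_
    · rw [D.E_F_self, smul_sub]
    · rw [smul_mul_assoc, D.k_F, hsym, mul_smul_comm, smul_smul, smul_smul, zpow_neg,
        mul_right_comm, mul_inv_cancel₀ (zpow_ne_zero _ h0), one_mul]
    · rw [smul_mul_assoc, D.kinv_F hq, hsym, mul_smul_comm, smul_smul, smul_smul, hz, pow_mul']
      congr 1
      field_simp
  · have := mul_ySeq_of_mul (q := q) (t := q ^ cM i j) (k := D.E l) (a := D.F i) (y := D.F j) 1 1
      (by rw [one_smul, D.E_F l i hli]) (by rw [one_smul, D.E_F l j hlj]) (m + 1)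
    rw [one_mul, one_pow, one_smul] at this
    exact this

/-- The Serre element built from the `E_i` commutes with the `F_l`. -/
theorem commute_F_serreSum (hi : cM i i = 2) (hsym : cM j i = cM i j) (hc : cM i j ≤ 0) (l : II) :
    Commute (D.F l) (serreSum K q (D.E i) (D.E j) (cM i j)) :=
  (D.swap hq).commute_E_serreSum hq hij hi hsym hc l

end QuantumData

section SerreSum

variable {K : Type} [Field K] {A : Type w} [Ring A] [Algebra K A] {B : Type w'} [Ring B]
  [Algebra K B]

theorem map_serreSum (f : A →ₐ[K] B) (q : K) (x y : A) (c : ℤ) :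
    f (serreSum K q x y c) = serreSum K q (f x) (f y) c := by
  simp only [serreSum, dividedPow, map_sum, map_smul, map_mul, map_pow]

theorem serreSum_smul (q : K) (x y : A) (α β : K) (c : ℤ) :
    serreSum K q (α • x) (β • y) c = (α ^ (1 - c).toNat * β) • serreSum K q x y c := by
  rw [serreSum, serreSum, Finset.smul_sum]
  refine Finset.sum_congr rfl fun r hr => ?_
  have hr' : r + ((1 - c).toNat - r) = (1 - c).toNat := by
    have := Finset.mem_range.1 hr; omega
  simp only [dividedPow, smul_pow, smul_mul_assoc, mul_smul_comm, smul_smul]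
  congr 1
  generalize (1 - c).toNat - r = l at hr' ⊢
  rw [← hr', pow_add]
  ring

end SerreSum

section FreeAlgebra

variable {K : Type} [Field K] {II : Type}

theorem freeAlgebra_left_induction {p : FreeAlgebra K II → Prop} (h1 : p 1)
    (hadd : ∀ a b, p a → p b → p (a + b)) (hsmul : ∀ (c : K) a, p a → p (c • a))
    (hmul : ∀ i a, p a → p (FreeAlgebra.ι K i * a)) (x : FreeAlgebra K II) : p x := by
  have key : ∀ x : FreeAlgebra K II, ∀ z, p z → p (x * z) := by
    intro x
    induction x using FreeAlgebra.induction with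
    | grade0 r => intro z hz; rw [← Algebra.smul_def]; exact hsmul r z hz
    | grade1 i => exact fun z hz => hmul i z hz
    | mul a b ha hb => intro z hz; rw [mul_assoc]; exact ha _ (hb _ hz)
    | add a b ha hb => intro z hz; rw [add_mul]; exact hadd _ _ (ha _ hz) (hb _ hz)
  simpa using key x 1 h1

theorem freeAlgebra_linearMap_ext {M : Type*} [AddCommGroup M] [Module K M]
    {f g : FreeAlgebra K II →ₗ[K] M} (h1 : f 1 = g 1)
    (hmul : ∀ i a, f a = g a → f (FreeAlgebra.ι K i * a) = g (FreeAlgebra.ι K i * a)) : f = g := by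
  ext x
  induction x using freeAlgebra_left_induction with
  | h1 => exact h1
  | hadd a b ha hb => rw [map_add, map_add, ha, hb]
  | hsmul c a ha => rw [map_smul, map_smul, ha]
  | hmul i a ha => exact hmul i a ha

end FreeAlgebra

section Verma

variable {K : Type} [Field K] {II : Type}

/-- The algebra endomorphism rescaling the generators. -/
def scaleHom (s : II → K) : FreeAlgebra K II →ₐ[K] FreeAlgebra K II :=
  FreeAlgebra.lift K fun j => s j • FreeAlgebra.ι K j

theorem scaleHom_ι (s : II → K) (j : II) :
    scaleHom s (FreeAlgebra.ι K j) = s j • FreeAlgebra.ι K j := by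
  simp [scaleHom]

theorem scaleHom_scaleHom (s t : II → K) (z : FreeAlgebra K II) :
    scaleHom s (scaleHom t z) = scaleHom (s * t) z := by
  have : (scaleHom s).comp (scaleHom t) = scaleHom (s * t) := by
    ext j
    simp [scaleHom_ι, smul_smul, mul_comm]
  exact DFunLike.congr_fun this z

theorem scaleHom_one (z : FreeAlgebra K II) : scaleHom (1 : II → K) z = z := by
  have : scaleHom (1 : II → K) = AlgHom.id K _ := by
    ext j
    simp [scaleHom_ι]
  exact DFunLike.congr_fun this z

open Classical in
/-- The auxiliary representation whose off-diagonal entry is the skew derivation `skewDer`. -/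
def skewRep (s : II → K) (c : K) (i : II) :
    FreeAlgebra K II →ₐ[K] Module.End K (FreeAlgebra K II × FreeAlgebra K II) :=
  FreeAlgebra.lift K fun j =>
    LinearMap.prod
      (LinearMap.mulLeft K (FreeAlgebra.ι K j) ∘ₗ LinearMap.fst K _ _ +
        (if i = j then c else 0) •
          ((scaleHom s).toLinearMap - (scaleHom s⁻¹).toLinearMap) ∘ₗ LinearMap.snd K _ _)
      (LinearMap.mulLeft K (FreeAlgebra.ι K j) ∘ₗ LinearMap.snd K _ _)

/-- The operator `E_i` on the universal Verma module, identified with the free algebra. -/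
def skewDer (s : II → K) (c : K) (i : II) : Module.End K (FreeAlgebra K II) :=
  LinearMap.fst K _ _ ∘ₗ LinearMap.applyₗ (0, 1) ∘ₗ (skewRep s c i).toLinearMap

theorem skewRep_apply_snd (s : II → K) (c : K) (i : II) (z : FreeAlgebra K II) :
    (skewRep s c i z (0, 1)).2 = z := by
  induction z using freeAlgebra_left_induction with
  | h1 => simp
  | hadd a b ha hb => simp [ha, hb]
  | hsmul c a ha => simp [ha]
  | hmul i a ha =>
    rw [map_mul, Module.End.mul_apply]
    conv_rhs => rw [← ha]
    simp [skewRep]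

theorem skewDer_one (s : II → K) (c : K) (i : II) : skewDer s c i 1 = 0 := by
  simp [skewDer]

open Classical in
theorem skewDer_ι_mul (s : II → K) (c : K) (i j : II) (z : FreeAlgebra K II) :
    skewDer s c i (FreeAlgebra.ι K j * z) = FreeAlgebra.ι K j * skewDer s c i z +
      (if i = j then c else 0) • (scaleHom s z - scaleHom s⁻¹ z) := by
  have h := skewRep_apply_snd s c i z
  simp only [skewDer, LinearMap.comp_apply, AlgHom.toLinearMap_apply, map_mul,
    LinearMap.applyₗ_apply_apply, Module.End.mul_apply]
  generalize skewRep s c i z (0, 1) = w at *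
  subst h
  by_cases h : i = j <;> simp [skewRep, h]

variable (cM : II → II → ℤ) {q : K} (hq : IsGeneric q)

/-- The quantum group relations, except the Serre relations, hold on the Verma module of the
quantum group without Serre relations. -/
def verma : QuantumData K cM q (Module.End K (FreeAlgebra K II)) where
  E i := skewDer (fun j => q ^ (-cM i j)) (q - q⁻¹)⁻¹ i
  F i := LinearMap.mulLeft K (FreeAlgebra.ι K i)
  k i := (scaleHom fun j => q ^ (-cM i j)).toLinearMap
  kinv i := (scaleHom (fun j => q ^ (-cM i j))⁻¹).toLinearMap
  k_comm i j := by
    ext z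
    simp [scaleHom_scaleHom, mul_comm]
  k_kinv i := by
    have h0 := hq.ne_zero
    have : (fun j => q ^ (-cM i j)) * (fun j => q ^ (-cM i j))⁻¹ = 1 := by
      ext j
      exact mul_inv_cancel₀ (zpow_ne_zero _ h0)
    ext z
    simp only [Module.End.mul_apply, AlgHom.toLinearMap_apply, scaleHom_scaleHom, this,
      scaleHom_one, Module.End.one_apply]
  kinv_k i := by
    have h0 := hq.ne_zero
    have : (fun j => q ^ (-cM i j))⁻¹ * (fun j => q ^ (-cM i j)) = 1 := by
      ext j
      exact inv_mul_cancel₀ (zpow_ne_zero _ h0)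
    ext z
    simp only [Module.End.mul_apply, AlgHom.toLinearMap_apply, scaleHom_scaleHom, this,
      scaleHom_one, Module.End.one_apply]
  k_E i j := by
    classical
    have h0 := zpow_ne_zero (cM i j) hq.ne_zero
    refine freeAlgebra_linearMap_ext (by simp [skewDer_one]) fun l z h => ?_
    simp only [Module.End.mul_apply, AlgHom.toLinearMap_apply, LinearMap.smul_apply, map_mul,
      skewDer_ι_mul, map_add, map_smul, map_sub, scaleHom_ι, smul_mul_assoc,
      scaleHom_scaleHom] at h ⊢
    rw [h]
    by_cases hjl : j = l
    · subst hjl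
      simp only [if_true, mul_smul_comm, smul_add, smul_smul, zpow_neg, mul_inv_cancel₀ h0,
        inv_mul_cancel₀ h0, mul_inv_cancel_left₀ h0, one_smul, mul_comm (fun j => (q ^ cM i j)⁻¹)]
    · simp only [hjl, if_false, zero_smul, add_zero, mul_smul_comm]
      rw [smul_comm]
  k_F i j := by
    ext z
    simp [scaleHom_ι]
  E_F_self i := by
    ext z
    simp [skewDer_ι_mul]
  E_F i j h := by
    ext z
    simp [skewDer_ι_mul, h]

theorem verma_E_one (i : II) : (verma cM hq).E i 1 = 0 := skewDer_one _ _ i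

theorem verma_serreSum_E_eq_zero {i j : II} (hij : i ≠ j) (hi : cM i i = 2)
    (hsym : cM j i = cM i j) (hc : cM i j ≤ 0) :
    serreSum K q ((verma cM hq).E i) ((verma cM hq).E j) (cM i j) = 0 := by
  refine freeAlgebra_linearMap_ext ?_ fun l z hz => ?_
  · rw [serreSum, LinearMap.sum_apply]
    refine Finset.sum_eq_zero fun r _ => ?_
    simp only [dividedPow, LinearMap.smul_apply, Module.End.mul_apply]
    cases (1 - cM i j).toNat - r with
    | zero => simp [verma_E_one]
    | succ n => simp [pow_succ, verma_E_one]
  · have h := LinearMap.congr_fun ((verma cM hq).commute_F_serreSum hq hij hi hsym hc l).eq z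
    rw [Module.End.mul_apply, Module.End.mul_apply, hz] at h
    rw [LinearMap.zero_apply] at h ⊢
    rw [map_zero] at h
    exact h.symm

theorem verma_serreSum_F (i j : II) (c : ℤ) :
    serreSum K q ((verma cM hq).F i) ((verma cM hq).F j) c =
      LinearMap.mulLeft K (serreSum K q (FreeAlgebra.ι K i) (FreeAlgebra.ι K j) c) :=
  (map_serreSum (Algebra.lmul K (FreeAlgebra K II)) q _ _ c).symm

end Verma

section Quotient

variable {K : Type} [Field K] {II : Type} (cM : II → II → ℤ) {q : K}

variable (q) in
/-- The two-sided ideal generated by the Serre elements, as a subspace. -/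
def serreIdeal : Submodule K (FreeAlgebra K II) :=
  Submodule.span K {x | ∃ a b i j, i ≠ j ∧
    x = a * serreSum K q (FreeAlgebra.ι K i) (FreeAlgebra.ι K j) (cM i j) * b}

theorem mul_serreSum_mul_mem {i j : II} (hij : i ≠ j) (a b : FreeAlgebra K II) :
    a * serreSum K q (FreeAlgebra.ι K i) (FreeAlgebra.ι K j) (cM i j) * b ∈ serreIdeal cM q :=
  Submodule.subset_span ⟨a, b, i, j, hij, rfl⟩

theorem mul_mem_serreIdeal (z : FreeAlgebra K II) {x : FreeAlgebra K II}
    (hx : x ∈ serreIdeal cM q) : z * x ∈ serreIdeal cM q := by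
  induction hx using Submodule.span_induction with
  | mem x hx =>
    obtain ⟨a, b, i, j, hij, rfl⟩ := hx
    rw [mul_assoc a, ← mul_assoc z, ← mul_assoc]
    exact mul_serreSum_mul_mem cM hij _ _
  | zero => simp
  | add x y _ _ hx hy => rw [mul_add]; exact add_mem hx hy
  | smul c x _ hx => rw [mul_smul_comm]; exact Submodule.smul_mem _ _ hx

theorem scaleHom_mem_serreIdeal (s : II → K) {x : FreeAlgebra K II}
    (hx : x ∈ serreIdeal cM q) : scaleHom s x ∈ serreIdeal cM q := by
  induction hx using Submodule.span_induction with
  | mem x hx =>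
    obtain ⟨a, b, i, j, hij, rfl⟩ := hx
    rw [map_mul, map_mul, map_serreSum, scaleHom_ι, scaleHom_ι, serreSum_smul, mul_smul_comm,
      smul_mul_assoc]
    exact Submodule.smul_mem _ _ (mul_serreSum_mul_mem cM hij _ _)
  | zero => simp
  | add x y _ _ hx hy => rw [map_add]; exact add_mem hx hy
  | smul c x _ hx => rw [map_smul]; exact Submodule.smul_mem _ _ hx

variable (hq : IsGeneric q) (hsym : ∀ i j, cM i j = cM j i) (hdiag : ∀ i, cM i i = 2)
  (hoff : ∀ i j, i ≠ j → cM i j ≤ 0)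
include hsym hdiag hoff

theorem verma_E_mem_serreIdeal (l : II) {x : FreeAlgebra K II} (hx : x ∈ serreIdeal cM q) :
    (verma cM hq).E l x ∈ serreIdeal cM q := by
  classical
  induction hx using Submodule.span_induction with
  | mem x hx =>
    obtain ⟨a, b, i, j, hij, rfl⟩ := hx
    induction a using freeAlgebra_left_induction with
    | h1 =>
      have h := LinearMap.congr_fun
        ((verma cM hq).commute_E_serreSum hq hij (hdiag i) (hsym j i) (hoff i j hij) l).eq b
      simp only [verma_serreSum_F, Module.End.mul_apply, LinearMap.mulLeft_apply] at h
      rw [one_mul, h]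
      simpa using mul_serreSum_mul_mem cM hij 1 _
    | hadd a a' ha ha' => rw [add_mul, add_mul, map_add]; exact add_mem ha ha'
    | hsmul c a ha =>
      rw [smul_mul_assoc, smul_mul_assoc, map_smul]
      exact Submodule.smul_mem _ _ ha
    | hmul k a ha =>
      rw [mul_assoc, mul_assoc, ← mul_assoc a]
      have h := mul_serreSum_mul_mem (q := q) cM hij a b
      have e := skewDer_ι_mul (fun j => q ^ (-cM l j)) (q - q⁻¹)⁻¹ l k
        (a * serreSum K q (FreeAlgebra.ι K i) (FreeAlgebra.ι K j) (cM i j) * b)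
      change skewDer _ _ l _ ∈ _
      rw [e]
      refine add_mem (mul_mem_serreIdeal cM _ ha)
        (Submodule.smul_mem _ _ (sub_mem ?_ ?_)) <;> exact scaleHom_mem_serreIdeal cM _ h
  | zero => simp
  | add x y _ _ hx hy => rw [map_add]; exact add_mem hx hy
  | smul c x _ hx => rw [map_smul]; exact Submodule.smul_mem _ _ hx

end Quotient

namespace QuantumData

variable {K : Type} [Field K] {II : Type} {cM : II → II → ℤ} {q : K} {A A' : Type*}
    [Ring A] [Algebra K A] [Ring A'] [Algebra K A']

/-- The image of a quantum datum under an algebra homomorphism. -/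
def map (D : QuantumData K cM q A) (f : A →ₐ[K] A') : QuantumData K cM q A' where
  E i := f (D.E i)
  F i := f (D.F i)
  k i := f (D.k i)
  kinv i := f (D.kinv i)
  k_comm i j := by simpa using congrArg f (D.k_comm i j)
  k_kinv i := by simpa using congrArg f (D.k_kinv i)
  kinv_k i := by simpa using congrArg f (D.kinv_k i)
  k_E i j := by simpa only [map_mul, map_smul] using congrArg f (D.k_E i j)
  k_F i j := by simpa only [map_mul, map_smul] using congrArg f (D.k_F i j)
  E_F_self i := by simpa only [map_mul, map_smul, map_sub] using congrArg f (D.E_F_self i)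
  E_F i j h := by simpa only [map_mul] using congrArg f (D.E_F i j h)

/-- A quantum datum contained in a subalgebra. -/
def codRestrict (D : QuantumData K cM q A) (S : Subalgebra K A) (hE : ∀ i, D.E i ∈ S)
    (hF : ∀ i, D.F i ∈ S) (hk : ∀ i, D.k i ∈ S) (hkinv : ∀ i, D.kinv i ∈ S) :
    QuantumData K cM q S where
  E i := ⟨D.E i, hE i⟩
  F i := ⟨D.F i, hF i⟩
  k i := ⟨D.k i, hk i⟩
  kinv i := ⟨D.kinv i, hkinv i⟩
  k_comm i j := Subtype.ext (D.k_comm i j)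
  k_kinv i := Subtype.ext (D.k_kinv i)
  kinv_k i := Subtype.ext (D.kinv_k i)
  k_E i j := Subtype.ext (D.k_E i j)
  k_F i j := Subtype.ext (D.k_F i j)
  E_F_self i := Subtype.ext (D.E_F_self i)
  E_F i j h := Subtype.ext (D.E_F i j h)

/-- The generators of the ıquantum group. -/
def B (D : QuantumData K cM q A) (i : II) : A := D.F i + D.E' i

theorem map_B (D : QuantumData K cM q A) (f : A →ₐ[K] A') (i : II) :
    f (D.B i) = (D.map f).B i := by
  simp only [QuantumData.B, E', map_add, map_smul, map_mul, map]

variable (K II cM q) in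
/-- The quantum datum of the quantum group. -/
def ofUQ : QuantumData K cM q (UQ K II cM q) where
  E := uE K II cM q
  F := uF K II cM q
  k i := RingQuot.mkAlgHom K _ (FreeAlgebra.ι K (QGen.K i))
  kinv := uKinv K II cM q
  k_comm i j := by
    have h := RingQuot.mkAlgHom_rel K (QRel.KKcomm (cM := cM) (vq := q) i j)
    simp only [map_mul] at h
    exact h
  k_kinv i := by
    have h := RingQuot.mkAlgHom_rel K (QRel.KKinv (cM := cM) (vq := q) i)
    simp only [map_mul, map_one] at h
    exact h
  kinv_k i := by
    have h := RingQuot.mkAlgHom_rel K (QRel.KinvK (cM := cM) (vq := q) i)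
    simp only [map_mul, map_one] at h
    exact h
  k_E i j := by
    have h := RingQuot.mkAlgHom_rel K (QRel.KE (cM := cM) (vq := q) i j)
    simp only [map_mul, map_smul] at h
    exact h
  k_F i j := by
    have h := RingQuot.mkAlgHom_rel K (QRel.KF (cM := cM) (vq := q) i j)
    simp only [map_mul, map_smul] at h
    exact h
  E_F_self i := by
    have h := RingQuot.mkAlgHom_rel K (QRel.EF (cM := cM) (vq := q) i i)
    simp only [map_mul, map_smul, map_sub, if_true] at h
    exact h
  E_F i j hij := by
    have h := RingQuot.mkAlgHom_rel K (QRel.EF (cM := cM) (vq := q) i j)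
    simp only [map_mul, map_sub, if_neg hij, map_zero] at h
    exact sub_eq_zero.1 h

theorem ofUQ_serreSum_E {i j : II} (hij : i ≠ j) :
    serreSum K q ((ofUQ K II cM q).E i) ((ofUQ K II cM q).E j) (cM i j) = 0 := by
  have := RingQuot.mkAlgHom_rel K (QRel.serreE (cM := cM) (vq := q) i j hij)
  rwa [map_serreSum, map_zero] at this

theorem ofUQ_serreSum_F {i j : II} (hij : i ≠ j) :
    serreSum K q ((ofUQ K II cM q).F i) ((ofUQ K II cM q).F j) (cM i j) = 0 := by
  have := RingQuot.mkAlgHom_rel K (QRel.serreF (cM := cM) (vq := q) i j hij)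
  rwa [map_serreSum, map_zero] at this

/-- The generators of a quantum datum. -/
def gen (D : QuantumData K cM q A) : QGen II → A
  | .E i => D.E i
  | .F i => D.F i
  | .K i => D.k i
  | .Kinv i => D.kinv i

/-- The universal property of the quantum group. -/
def lift (D : QuantumData K cM q A)
    (hE : ∀ i j, i ≠ j → serreSum K q (D.E i) (D.E j) (cM i j) = 0)
    (hF : ∀ i j, i ≠ j → serreSum K q (D.F i) (D.F j) (cM i j) = 0) : UQ K II cM q →ₐ[K] A :=
  RingQuot.liftAlgHom K ⟨FreeAlgebra.lift K D.gen, fun x y h => by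
    induction h with
    | KKcomm i j => simpa [gen] using D.k_comm i j
    | KKinv i => simpa [gen] using D.k_kinv i
    | KinvK i => simpa [gen] using D.kinv_k i
    | KE i j => simpa [gen] using D.k_E i j
    | KF i j =>
      simpa only [map_mul, map_smul, FreeAlgebra.lift_ι_apply, gen] using D.k_F i j
    | EF i j =>
      split_ifs with h
      · subst h
        simpa only [map_mul, map_smul, map_sub, FreeAlgebra.lift_ι_apply, gen] using D.E_F_self i
      · simpa only [map_mul, map_smul, map_sub, FreeAlgebra.lift_ι_apply, map_zero,
          sub_eq_zero, gen] using D.E_F i j h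
    | serreE i j h =>
      simpa only [map_serreSum, FreeAlgebra.lift_ι_apply, map_zero, gen] using hE i j h
    | serreF i j h =>
      simpa only [map_serreSum, FreeAlgebra.lift_ι_apply, map_zero, gen] using hF i j h⟩

theorem lift_B (D : QuantumData K cM q A)
    (hE : ∀ i j, i ≠ j → serreSum K q (D.E i) (D.E j) (cM i j) = 0)
    (hF : ∀ i j, i ≠ j → serreSum K q (D.F i) (D.F j) (cM i j) = 0) (i : II) :
    D.lift hE hF ((ofUQ K II cM q).B i) = D.B i := by
  have h (g : QGen II) : D.lift hE hF (RingQuot.mkAlgHom K _ (FreeAlgebra.ι K g)) = D.gen g :=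
    (RingQuot.liftAlgHom_mkAlgHom_apply _ _ _ _).trans (FreeAlgebra.lift_ι_apply _ _)
  simp only [B, E', map_add, map_smul, map_mul]
  exact congrArg₂ (fun a b => a + -q ^ (-2 : ℤ) • b) (h (.F i))
    (congrArg₂ (· * ·) (h (.E i)) (h (.Kinv i)))

theorem lift_B_eq_zero (D : QuantumData K cM q A)
    (hE : ∀ i j, i ≠ j → serreSum K q (D.E i) (D.E j) (cM i j) = 0)
    (hF : ∀ i j, i ≠ j → serreSum K q (D.F i) (D.F j) (cM i j) = 0) {f : FreeAlgebra K II}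
    (hf : FreeAlgebra.lift K (ofUQ K II cM q).B f = 0) : FreeAlgebra.lift K D.B f = 0 := by
  have e : (D.lift hE hF).comp (FreeAlgebra.lift K (ofUQ K II cM q).B) = FreeAlgebra.lift K D.B := by
    ext i
    simpa using D.lift_B hE hF i
  rw [← e, AlgHom.comp_apply, hf, map_zero]

theorem lift_map_B (D : QuantumData K cM q A) (g : A →ₐ[K] A') (f : FreeAlgebra K II) :
    FreeAlgebra.lift K (D.map g).B f = g (FreeAlgebra.lift K D.B f) := by
  have e : g.comp (FreeAlgebra.lift K D.B) = FreeAlgebra.lift K (D.map g).B := by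
    ext i
    simpa using D.map_B g i
  exact (DFunLike.congr_fun e f).symm

end QuantumData

section Stabilizer

variable {K : Type} [Field K] {M : Type*} [AddCommGroup M] [Module K M]

/-- The endomorphisms preserving a subspace. -/
def stabilizer (J : Submodule K M) : Subalgebra K (Module.End K M) where
  carrier := {f | J ≤ J.comap f}
  mul_mem' hf hg _ hx := hf (hg hx)
  add_mem' hf hg _ hx := J.add_mem (hf hx) (hg hx)
  algebraMap_mem' c _ hx := J.smul_mem c hx

/-- The action of the stabilizer on the quotient. -/
def quotientAction (J : Submodule K M) : stabilizer J →ₐ[K] Module.End K (M ⧸ J) where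
  toFun f := J.mapQ J f.1 (show J ≤ J.comap f.1 from f.2)
  map_one' := by ext; rfl
  map_mul' f g := by ext; rfl
  map_zero' := by ext; rfl
  map_add' f g := by ext; rfl
  commutes' c := by ext; rfl

variable {II : Type} {cM : II → II → ℤ} {q : K} (J : Submodule K M)
  (D : QuantumData K cM q (stabilizer J))

theorem quotientAction_eq_zero {f : stabilizer J} (h : ∀ x, f.1 x ∈ J) :
    quotientAction J f = 0 := by
  refine LinearMap.ext fun x => ?_
  obtain ⟨x, rfl⟩ := Submodule.Quotient.mk_surjective _ x
  exact (Submodule.Quotient.mk_eq_zero _).2 (h x)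

theorem QuantumData.quotientAction_lift_B_eq_zero
    (hE : ∀ i j, i ≠ j → serreSum K q (D.E i) (D.E j) (cM i j) = 0)
    (hF : ∀ i j, i ≠ j → ∀ x, (serreSum K q (D.F i) (D.F j) (cM i j)).1 x ∈ J)
    {f : FreeAlgebra K II} (hf : FreeAlgebra.lift K (ofUQ K II cM q).B f = 0) :
    quotientAction J (FreeAlgebra.lift K D.B f) = 0 := by
  rw [← QuantumData.lift_map_B]
  refine QuantumData.lift_B_eq_zero _ (fun i j hij => ?_) (fun i j hij => ?_) hf
  · refine (map_serreSum (quotientAction J) q _ _ _).symm.trans ?_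
    rw [hE i j hij, map_zero]
  · exact (map_serreSum (quotientAction J) q _ _ _).symm.trans
      (quotientAction_eq_zero J (hF i j hij))

theorem QuantumData.lift_B_apply_mem (D : QuantumData K cM q (Module.End K M))
    (hE' : ∀ i, ∀ x ∈ J, D.E i x ∈ J) (hF' : ∀ i, ∀ x ∈ J, D.F i x ∈ J)
    (hk : ∀ i, ∀ x ∈ J, D.k i x ∈ J) (hkinv : ∀ i, ∀ x ∈ J, D.kinv i x ∈ J)
    (hE : ∀ i j, i ≠ j → serreSum K q (D.E i) (D.E j) (cM i j) = 0)
    (hF : ∀ i j, i ≠ j → ∀ x, serreSum K q (D.F i) (D.F j) (cM i j) x ∈ J)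
    {f : FreeAlgebra K II} (hf : FreeAlgebra.lift K (ofUQ K II cM q).B f = 0) (z : M) :
    FreeAlgebra.lift K D.B f z ∈ J := by
  let D' := D.codRestrict (stabilizer J) hE' hF' hk hkinv
  have h1 := D'.quotientAction_lift_B_eq_zero J
    (fun i j hij => Subtype.ext ((map_serreSum (stabilizer J).val q _ _ _).trans (hE i j hij)))
    (fun i j hij x => by
      have := map_serreSum (stabilizer J).val q (D'.F i) (D'.F j) (cM i j)
      refine (LinearMap.congr_fun this x) ▸ hF i j hij x) hf
  have h2 := (QuantumData.lift_map_B D' (stabilizer J).val f).symm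
  refine (LinearMap.congr_fun h2 z) ▸ ?_
  exact (Submodule.Quotient.mk_eq_zero _).1
    (LinearMap.congr_fun h1 (Submodule.Quotient.mk z))

end Stabilizer

section Action

variable {K : Type} [Field K] {II : Type} (cM : II → II → ℤ) {q : K}
variable (hq : IsGeneric q) (hsym : ∀ i j, cM i j = cM j i) (hdiag : ∀ i, cM i i = 2)
  (hoff : ∀ i j, i ≠ j → cM i j ≤ 0)
include hsym hdiag hoff

/-- A noncommutative polynomial vanishing at the generators of the ıquantum group maps the Verma
module into the span of the Serre elements. -/
theorem lift_verma_B_mem_serreIdeal {f : FreeAlgebra K II}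
    (hf : FreeAlgebra.lift K (QuantumData.ofUQ K II cM q).B f = 0) (z : FreeAlgebra K II) :
    FreeAlgebra.lift K (verma cM hq).B f z ∈ serreIdeal cM q := by
  refine QuantumData.lift_B_apply_mem (serreIdeal cM q) (verma cM hq)
    (fun _ _ hx => verma_E_mem_serreIdeal cM hq hsym hdiag hoff _ hx)
    (fun _ _ hx => mul_mem_serreIdeal cM _ hx)
    (fun _ _ hx => scaleHom_mem_serreIdeal cM _ hx)
    (fun _ _ hx => scaleHom_mem_serreIdeal cM _ hx)
    (fun i j hij => verma_serreSum_E_eq_zero cM hq hij (hdiag i) (hsym j i) (hoff i j hij))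
    (fun i j hij x => ?_) hf z
  rw [verma_serreSum_F, LinearMap.mulLeft_apply]
  simpa using mul_serreSum_mul_mem cM hij 1 x

end Action

section Words

variable {K : Type} [Field K] {II : Type}

variable (K) in
/-- The monomial of a word in the free algebra. -/
def word (l : List II) : FreeAlgebra K II := (l.map (FreeAlgebra.ι K)).prod

theorem word_cons (i : II) (l : List II) : word K (i :: l) = FreeAlgebra.ι K i * word K l := by
  simp [word]

theorem word_mul_word (l l' : List II) : word K l * word K l' = word K (l ++ l') := by
  simp [word]

theorem span_range_word : Submodule.span K (Set.range (word K (II := II))) = ⊤ := by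
  refine Submodule.eq_top_iff'.2 fun x => ?_
  induction x using freeAlgebra_left_induction with
  | h1 => exact Submodule.subset_span ⟨[], rfl⟩
  | hadd a b ha hb => exact add_mem ha hb
  | hsmul c a ha => exact Submodule.smul_mem _ _ ha
  | hmul i a ha =>
    induction ha using Submodule.span_induction with
    | mem x hx =>
      obtain ⟨l, rfl⟩ := hx
      exact Submodule.subset_span ⟨i :: l, word_cons i l⟩
    | zero => simp
    | add x y _ _ hx hy => rw [mul_add]; exact add_mem hx hy
    | smul c x _ hx => rw [mul_smul_comm]; exact Submodule.smul_mem _ _ hx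

variable (K II) in
/-- The span of the words of length less than `d`. -/
def wordFiltration (d : ℕ) : Submodule K (FreeAlgebra K II) :=
  Submodule.span K (word K '' {l | l.length < d})

theorem word_mem_wordFiltration {l : List II} {d : ℕ} (h : l.length < d) :
    word K l ∈ wordFiltration K II d := Submodule.subset_span ⟨l, h, rfl⟩

theorem one_mem_wordFiltration (d : ℕ) : (1 : FreeAlgebra K II) ∈ wordFiltration K II (d + 1) :=
  word_mem_wordFiltration (l := []) (by simp)

theorem ι_mem_wordFiltration (i : II) : FreeAlgebra.ι K i ∈ wordFiltration K II 2 := by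
  simpa [word] using word_mem_wordFiltration (K := K) (l := [i]) (d := 2) (by simp)

theorem wordFiltration_mono {d e : ℕ} (h : d ≤ e) : wordFiltration K II d ≤ wordFiltration K II e :=
  Submodule.span_mono (Set.image_mono fun _ hl => lt_of_lt_of_le hl h)

theorem mul_mem_wordFiltration {d e f : ℕ} (h : d + e ≤ f + 1) {x y : FreeAlgebra K II}
    (hx : x ∈ wordFiltration K II d) (hy : y ∈ wordFiltration K II e) :
    x * y ∈ wordFiltration K II f := by
  induction hx using Submodule.span_induction with
  | mem x hx =>
    obtain ⟨l, hl, rfl⟩ := hx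
    induction hy using Submodule.span_induction with
    | mem y hy =>
      obtain ⟨l', hl', rfl⟩ := hy
      rw [word_mul_word]
      refine word_mem_wordFiltration ?_
      simp only [Set.mem_ofPred_eq, List.length_append] at *
      omega
    | zero => simp
    | add x y _ _ hx hy => rw [mul_add]; exact add_mem hx hy
    | smul c x _ hx => rw [mul_smul_comm]; exact Submodule.smul_mem _ _ hx
  | zero => simp
  | add x y _ _ hx hy => rw [add_mul]; exact add_mem hx hy
  | smul c x _ hx => rw [smul_mul_assoc]; exact Submodule.smul_mem _ _ hx

theorem exists_mem_wordFiltration (x : FreeAlgebra K II) : ∃ d, x ∈ wordFiltration K II d := by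
  have hx : x ∈ Submodule.span K (Set.range (word K (II := II))) := by
    rw [span_range_word]
    trivial
  induction hx using Submodule.span_induction with
  | mem x hx =>
    obtain ⟨l, rfl⟩ := hx
    exact ⟨l.length + 1, word_mem_wordFiltration l.length.lt_succ_self⟩
  | zero => exact ⟨0, zero_mem _⟩
  | add x y _ _ hx hy =>
    obtain ⟨d, hd⟩ := hx
    obtain ⟨e, he⟩ := hy
    exact ⟨max d e, add_mem (wordFiltration_mono (le_max_left _ _) hd)
      (wordFiltration_mono (le_max_right _ _) he)⟩
  | smul c x _ hx =>
    obtain ⟨d, hd⟩ := hx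
    exact ⟨d, Submodule.smul_mem _ _ hd⟩

variable (K II) in
/-- The homomorphism recording the degree of a homogeneous element. -/
def degreeHom : FreeAlgebra K II →ₐ[K] Polynomial (FreeAlgebra K II) :=
  FreeAlgebra.lift K fun i => Polynomial.monomial 1 (FreeAlgebra.ι K i)

variable (K II) in
/-- The projection to the homogeneous component of degree `n`. -/
def component (n : ℕ) : FreeAlgebra K II →ₗ[K] FreeAlgebra K II :=
  (Polynomial.lcoeff (FreeAlgebra K II) n).restrictScalars K ∘ₗ (degreeHom K II).toLinearMap

theorem degreeHom_word (l : List II) :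
    degreeHom K II (word K l) = Polynomial.monomial l.length (word K l) := by
  induction l with
  | nil => simp [word]
  | cons i l ih =>
    rw [word_cons, map_mul, ih, degreeHom, FreeAlgebra.lift_ι_apply,
      Polynomial.monomial_mul_monomial, List.length_cons, add_comm]

theorem degreeHom_ι (i : II) :
    degreeHom K II (FreeAlgebra.ι K i) = Polynomial.monomial 1 (FreeAlgebra.ι K i) := by
  simp [degreeHom]

theorem component_of_degreeHom {x : FreeAlgebra K II} {d : ℕ}
    (h : degreeHom K II x = Polynomial.monomial d x) (n : ℕ) :
    component K II n x = if d = n then x else 0 := by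
  simp [component, h, Polynomial.coeff_monomial]

theorem sub_component_mem_wordFiltration {n : ℕ} {x : FreeAlgebra K II}
    (hx : x ∈ wordFiltration K II (n + 1)) : x - component K II n x ∈ wordFiltration K II n := by
  induction hx using Submodule.span_induction with
  | mem x hx =>
    obtain ⟨l, hl, rfl⟩ := hx
    rw [component_of_degreeHom (degreeHom_word l)]
    split_ifs with h
    · simp
    · rw [sub_zero]
      exact word_mem_wordFiltration (lt_of_le_of_ne (Nat.lt_succ_iff.1 hl) h)
  | zero => simp
  | add x y _ _ hx hy => rw [map_add, add_sub_add_comm]; exact add_mem hx hy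
  | smul c x _ hx => rw [map_smul, ← smul_sub]; exact Submodule.smul_mem _ _ hx

theorem degreeHom_serreSum (q : K) (i j : II) (c : ℤ) :
    degreeHom K II (serreSum K q (FreeAlgebra.ι K i) (FreeAlgebra.ι K j) c) =
      Polynomial.monomial ((1 - c).toNat + 1)
        (serreSum K q (FreeAlgebra.ι K i) (FreeAlgebra.ι K j) c) := by
  rw [map_serreSum, serreSum, serreSum, map_sum]
  refine Finset.sum_congr rfl fun r hr => ?_
  have hr' : r + 1 + ((1 - c).toNat - r) = (1 - c).toNat + 1 := by
    have := Finset.mem_range.1 hr; omega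
  simp only [dividedPow, degreeHom_ι, Polynomial.monomial_pow, Polynomial.smul_monomial,
    Polynomial.monomial_mul_monomial, one_mul, hr']

end Words

section Filtration

variable {K : Type} [Field K] {II : Type}

theorem iSeq_mem_wordFiltration (q w : K) (i : II) (p : ZMod 2) (n : ℕ) :
    iSeq q w (FreeAlgebra.ι K i) p n ∈ wordFiltration K II (n + 1) := by
  induction n using Nat.twoStepInduction with
  | zero => exact one_mem_wordFiltration 0
  | one => exact ι_mem_wordFiltration i
  | more n h1 h2 =>
    exact add_mem (mul_mem_wordFiltration (by omega) (ι_mem_wordFiltration i) h2)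
      (Submodule.smul_mem _ _ (wordFiltration_mono (by omega) h1))

theorem iSeq_sub_iSeq_mem_wordFiltration (q w w' : K) (i : II) (p : ZMod 2) (n : ℕ) :
    iSeq q w (FreeAlgebra.ι K i) p n - iSeq q w' (FreeAlgebra.ι K i) p n ∈
      wordFiltration K II n := by
  induction n using Nat.twoStepInduction with
  | zero => simp [iSeq]
  | one => simp [iSeq]
  | more n h1 h2 =>
    rw [iSeq, iSeq, add_sub_add_comm, ← mul_sub]
    refine add_mem (mul_mem_wordFiltration (by omega) (ι_mem_wordFiltration i) h2)
      (sub_mem ?_ ?_) <;>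
    exact Submodule.smul_mem _ _
      (wordFiltration_mono (by omega) (iSeq_mem_wordFiltration q _ i p n))

theorem bimodSum_sub_bimodSum_mem_wordFiltration (q w w' : K) (i j : II) (p p' : ZMod 2) (m : ℕ) :
    bimodSum q w (FreeAlgebra.ι K i) (FreeAlgebra.ι K j) p p' m -
      bimodSum q w' (FreeAlgebra.ι K i) (FreeAlgebra.ι K j) p p' m ∈
      wordFiltration K II (m + 1) := by
  rw [bimodSum, bimodSum, ← Finset.sum_sub_distrib]
  refine Submodule.sum_mem _ fun r hr => ?_
  have hr := Finset.HasAntidiagonal.mem_antidiagonal.1 hr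
  rw [← smul_sub]
  refine Submodule.smul_mem _ _ ?_
  simp only [iDiv, smul_mul_assoc, mul_smul_comm, ← smul_sub]
  refine Submodule.smul_mem _ _ (Submodule.smul_mem _ _ ?_)
  have hj := ι_mem_wordFiltration (K := K) j
  have h1 := mul_mem_wordFiltration (f := m + 1) (by omega) (mul_mem_wordFiltration (f := r.1 + 1)
    (by omega) (iSeq_sub_iSeq_mem_wordFiltration q w w' i p r.1) hj)
    (iSeq_mem_wordFiltration q w i p' r.2)
  have h2 := mul_mem_wordFiltration (f := m + 1) (by omega) (mul_mem_wordFiltration (f := r.1 + 2)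
    (by omega) (iSeq_mem_wordFiltration q w' i p r.1) hj)
    (iSeq_sub_iSeq_mem_wordFiltration q w w' i p' r.2)
  convert add_mem h1 h2 using 1
  noncomm_ring

theorem scaleHom_mem_wordFiltration (s : II → K) {d : ℕ} {x : FreeAlgebra K II}
    (hx : x ∈ wordFiltration K II d) : scaleHom s x ∈ wordFiltration K II d := by
  induction hx using Submodule.span_induction with
  | mem x hx =>
    obtain ⟨l, hl, rfl⟩ := hx
    have : ∃ c : K, scaleHom s (word K l) = c • word K l := by
      clear hl
      induction l with
      | nil => exact ⟨1, by simp [word]⟩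
      | cons i l ih =>
        obtain ⟨c, hc⟩ := ih
        exact ⟨s i * c, by rw [word_cons, map_mul, hc, scaleHom_ι, smul_mul_smul_comm]⟩
    obtain ⟨c, hc⟩ := this
    rw [hc]
    exact Submodule.smul_mem _ _ (word_mem_wordFiltration hl)
  | zero => simp
  | add x y _ _ hx hy => rw [map_add]; exact add_mem hx hy
  | smul c x _ hx => rw [map_smul]; exact Submodule.smul_mem _ _ hx

theorem skewDer_mem_wordFiltration (s : II → K) (c : K) (i : II) {d : ℕ} {x : FreeAlgebra K II}
    (hx : x ∈ wordFiltration K II d) : skewDer s c i x ∈ wordFiltration K II d := by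
  classical
  induction hx using Submodule.span_induction with
  | mem x hx =>
    obtain ⟨l, hl, rfl⟩ := hx
    refine wordFiltration_mono (Nat.succ_le_of_lt hl) ?_
    clear hl
    induction l with
    | nil => simp [word, skewDer_one]
    | cons j l ih =>
      rw [word_cons, skewDer_ι_mul]
      have h : word K l ∈ wordFiltration K II (l.length + 1 + 1) :=
        word_mem_wordFiltration (by omega)
      exact add_mem (mul_mem_wordFiltration (by simp; omega) (ι_mem_wordFiltration j) ih)
        (Submodule.smul_mem _ _
          (sub_mem (scaleHom_mem_wordFiltration _ h) (scaleHom_mem_wordFiltration _ h)))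
  | zero => simp
  | add x y _ _ hx hy => rw [map_add]; exact add_mem hx hy
  | smul c x _ hx => rw [map_smul]; exact Submodule.smul_mem _ _ hx

variable (cM : II → II → ℤ) {q : K} (hq : IsGeneric q)

theorem verma_E'_mem_wordFiltration (i : II) {d : ℕ} {x : FreeAlgebra K II}
    (hx : x ∈ wordFiltration K II d) : (verma cM hq).E' i x ∈ wordFiltration K II d :=
  Submodule.smul_mem _ _ (skewDer_mem_wordFiltration _ _ i (scaleHom_mem_wordFiltration _ hx))

theorem lift_verma_B_one_sub_mem_wordFiltration {d : ℕ} {x : FreeAlgebra K II}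
    (hx : x ∈ wordFiltration K II (d + 1)) :
    FreeAlgebra.lift K (verma cM hq).B x 1 - x ∈ wordFiltration K II d := by
  induction hx using Submodule.span_induction with
  | mem x hx =>
    obtain ⟨l, hl, rfl⟩ := hx
    refine wordFiltration_mono (Nat.lt_succ_iff.1 hl) ?_
    clear hl
    induction l with
    | nil => simp [word]
    | cons j l ih =>
      rw [word_cons, map_mul, FreeAlgebra.lift_ι_apply, Module.End.mul_apply]
      have h : word K l ∈ wordFiltration K II (l.length + 1) :=
        word_mem_wordFiltration (by omega)
      generalize FreeAlgebra.lift K (verma cM hq).B (word K l) 1 = y at ih ⊢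
      have hy : y ∈ wordFiltration K II (l.length + 1) := by
        simpa using add_mem (wordFiltration_mono (Nat.le_succ _) ih) h
      have e : (verma cM hq).B j y - FreeAlgebra.ι K j * word K l =
          FreeAlgebra.ι K j * (y - word K l) + (verma cM hq).E' j y := by
        rw [mul_sub, sub_add_eq_add_sub]
        rfl
      rw [e]
      exact add_mem (mul_mem_wordFiltration (by simp; omega) (ι_mem_wordFiltration j) ih)
        (verma_E'_mem_wordFiltration cM hq j hy)
  | zero => simp
  | add x y _ _ hx hy => rw [map_add, LinearMap.add_apply, add_sub_add_comm]; exact add_mem hx hy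
  | smul c x _ hx =>
    rw [map_smul, LinearMap.smul_apply, ← smul_sub]; exact Submodule.smul_mem _ _ hx

end Filtration

section Presentation

variable {K : Type} [Field K] {II : Type} (cM : II → II → ℤ) {q : K} (pp : II → ZMod 2)

variable (q) in
/-- The projection from the free algebra to the algebra presented by the ıSerre relations. -/
def presentedMk : FreeAlgebra K II →ₐ[K] IPresented K II cM q pp := RingQuot.mkAlgHom K _

variable (q) in
/-- The noncommutative polynomials vanishing in the algebra presented by the ıSerre relations. -/
def iSerreKer : Submodule K (FreeAlgebra K II) := LinearMap.ker (presentedMk cM q pp).toLinearMap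

theorem mem_iSerreKer {x : FreeAlgebra K II} : x ∈ iSerreKer cM q pp ↔ presentedMk cM q pp x = 0 :=
  Iff.rfl

theorem presentedMk_iSerreSum {i j : II} (hij : i ≠ j) :
    presentedMk cM q pp
      (iSerreSum K q (FreeAlgebra.ι K i) (FreeAlgebra.ι K j) (cM i j) (pp i)) = 0 :=
  (RingQuot.mkAlgHom_rel K (ISRel.serre (cM := cM) (vq := q) i j hij)).trans (map_zero _)

theorem map_iSerreSum {A A' : Type*} [Ring A] [Algebra K A] [Ring A'] [Algebra K A']
    (f : A →ₐ[K] A') (x y : A) {c : ℤ} (hc : c ≤ 0) (p : ZMod 2) :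
    f (iSerreSum K q x y c p) = iSerreSum K q (f x) (f y) c p := by
  obtain ⟨m, rfl⟩ : ∃ m : ℕ, c = 1 - m := ⟨(1 - c).toNat, by omega⟩
  rw [iSerreSum_eq_bimodSum, iSerreSum_eq_bimodSum, map_bimodSum]

theorem serreSum_sub_iSerreSum_mem_wordFiltration {c : ℤ} (i j : II) (hc : c ≤ 0) (p : ZMod 2) :
    serreSum K q (FreeAlgebra.ι K i) (FreeAlgebra.ι K j) c -
      iSerreSum K q (FreeAlgebra.ι K i) (FreeAlgebra.ι K j) c p ∈
        wordFiltration K II ((1 - c).toNat + 1) := by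
  obtain ⟨m, rfl⟩ : ∃ m : ℕ, c = 1 - m := ⟨(1 - c).toNat, by omega⟩
  rw [serreSum_eq_bimodSum q _ _ p (1 - (m : ZMod 2) + p), iSerreSum_eq_bimodSum]
  simpa using bimodSum_sub_bimodSum_mem_wordFiltration q 0 q⁻¹ i j p (1 - (m : ZMod 2) + p) m

theorem component_word_mul_serreSum_mul_word_mem {i j : II} (hij : i ≠ j) (hc : cM i j ≤ 0)
    (a b : List II) (n : ℕ) :
    component K II n
      (word K a * serreSum K q (FreeAlgebra.ι K i) (FreeAlgebra.ι K j) (cM i j) * word K b) ∈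
        iSerreKer cM q pp ⊔ wordFiltration K II n := by
  have hS := degreeHom_serreSum q i j (cM i j)
  have hd := serreSum_sub_iSerreSum_mem_wordFiltration (q := q) i j hc (pp i)
  have h0 := presentedMk_iSerreSum (q := q) cM pp hij
  generalize serreSum K q (FreeAlgebra.ι K i) (FreeAlgebra.ι K j) (cM i j) = S at *
  generalize iSerreSum K q (FreeAlgebra.ι K i) (FreeAlgebra.ι K j) (cM i j) (pp i) = S' at *
  rw [component_of_degreeHom (d := a.length + ((1 - cM i j).toNat + 1) + b.length) (by
    rw [map_mul, map_mul, hS, degreeHom_word, degreeHom_word, Polynomial.monomial_mul_monomial,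
      Polynomial.monomial_mul_monomial])]
  split_ifs with h
  · have e : word K a * S * word K b =
        word K a * S' * word K b + word K a * (S - S') * word K b := by noncomm_ring
    rw [e]
    refine Submodule.add_mem_sup ?_ ?_
    · rw [mem_iSerreKer, map_mul, map_mul, h0, mul_zero, zero_mul]
    · refine mul_mem_wordFiltration (by omega) (mul_mem_wordFiltration
        (f := a.length + ((1 - cM i j).toNat + 1)) (by omega)
        (word_mem_wordFiltration a.length.lt_succ_self) hd)
        (word_mem_wordFiltration b.length.lt_succ_self)
  · exact zero_mem _

theorem component_mem_of_mem_serreIdeal (hoff : ∀ i j, i ≠ j → cM i j ≤ 0) (n : ℕ)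
    {x : FreeAlgebra K II} (hx : x ∈ serreIdeal cM q) :
    component K II n x ∈ iSerreKer cM q pp ⊔ wordFiltration K II n := by
  induction hx using Submodule.span_induction with
  | mem x hx =>
    obtain ⟨a, b, i, j, hij, rfl⟩ := hx
    have ha : a ∈ Submodule.span K (Set.range (word K (II := II))) := by
      rw [span_range_word]; trivial
    have hb : b ∈ Submodule.span K (Set.range (word K (II := II))) := by
      rw [span_range_word]; trivial
    induction ha using Submodule.span_induction with
    | mem a ha =>
      obtain ⟨la, rfl⟩ := ha
      induction hb using Submodule.span_induction with
      | mem b hb =>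
        obtain ⟨lb, rfl⟩ := hb
        exact component_word_mul_serreSum_mul_word_mem cM pp hij (hoff i j hij) la lb n
      | zero => simp
      | add x y _ _ hx hy => rw [mul_add, map_add]; exact add_mem hx hy
      | smul c x _ hx => rw [mul_smul_comm, map_smul]; exact Submodule.smul_mem _ _ hx
    | zero => simp
    | add x y _ _ hx hy => rw [add_mul, add_mul, map_add]; exact add_mem hx hy
    | smul c x _ hx =>
      rw [smul_mul_assoc, smul_mul_assoc, map_smul]; exact Submodule.smul_mem _ _ hx
  | zero => simp
  | add x y _ _ hx hy => rw [map_add]; exact add_mem hx hy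
  | smul c x _ hx => rw [map_smul]; exact Submodule.smul_mem _ _ hx

variable (hq : IsGeneric q) (hsym : ∀ i j, cM i j = cM j i) (hdiag : ∀ i, cM i i = 2)
  (hoff : ∀ i j, i ≠ j → cM i j ≤ 0)
include hq hsym hdiag hoff

theorem iSerreSum_ofUQ_B {i j : II} (hij : i ≠ j) (p : ZMod 2) :
    iSerreSum K q ((QuantumData.ofUQ K II cM q).B i) ((QuantumData.ofUQ K II cM q).B j)
      (cM i j) p = 0 :=
  (QuantumData.ofUQ K II cM q).iSerreSum_eq_zero hq hij (hdiag i) (hsym j i) (hoff i j hij)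
    (QuantumData.ofUQ_serreSum_E hij) (QuantumData.ofUQ_serreSum_F hij) p

/-- The homomorphism from the algebra presented by the ıSerre relations to the quantum group. -/
def presentedHom : IPresented K II cM q pp →ₐ[K] UQ K II cM q :=
  RingQuot.liftAlgHom K ⟨FreeAlgebra.lift K (QuantumData.ofUQ K II cM q).B, fun x y h => by
    induction h with
    | serre i j hij =>
      rw [map_zero, map_iSerreSum _ _ _ (hoff i j hij), FreeAlgebra.lift_ι_apply,
        FreeAlgebra.lift_ι_apply]
      exact iSerreSum_ofUQ_B cM hq hsym hdiag hoff hij (pp i)⟩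

theorem presentedHom_presentedMk (x : FreeAlgebra K II) :
    presentedHom cM pp hq hsym hdiag hoff (presentedMk cM q pp x) =
      FreeAlgebra.lift K (QuantumData.ofUQ K II cM q).B x :=
  RingQuot.liftAlgHom_mkAlgHom_apply K _ _ _

theorem presentedMk_eq_zero {x : FreeAlgebra K II}
    (hx : FreeAlgebra.lift K (QuantumData.ofUQ K II cM q).B x = 0) :
    presentedMk cM q pp x = 0 := by
  obtain ⟨d, hd⟩ := exists_mem_wordFiltration x
  induction d generalizing x with
  | zero =>
    have : x = 0 := by simpa [wordFiltration] using hd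
    rw [this, map_zero]
  | succ n ih =>
    have h1 := lift_verma_B_mem_serreIdeal cM hq hsym hdiag hoff hx 1
    have h2 := lift_verma_B_one_sub_mem_wordFiltration cM hq hd
    generalize FreeAlgebra.lift K (verma cM hq).B x 1 = g at h1 h2
    have h3 : g ∈ wordFiltration K II (n + 1) := by
      simpa using add_mem (wordFiltration_mono n.le_succ h2) hd
    have h4 := sub_component_mem_wordFiltration h3
    obtain ⟨h, hh, r, hr, e⟩ :=
      Submodule.mem_sup.1 (component_mem_of_mem_serreIdeal cM pp hoff n h1)
    rw [← e] at h4
    have h5 : x - h ∈ wordFiltration K II n := by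
      convert add_mem (sub_mem h4 h2) hr using 1
      abel
    rw [mem_iSerreKer] at hh
    have h6 := ih (x := x - h) (by
      rw [map_sub, hx, ← presentedHom_presentedMk cM pp hq hsym hdiag hoff, hh, map_zero,
        sub_zero]) h5
    rwa [map_sub, hh, sub_zero] at h6

theorem presentedHom_injective : Function.Injective (presentedHom cM pp hq hsym hdiag hoff) := by
  refine (injective_iff_map_eq_zero _).2 fun y hy => ?_
  obtain ⟨x, rfl⟩ : ∃ x, presentedMk cM q pp x = y := RingQuot.mkAlgHom_surjective K _ y
  rw [presentedHom_presentedMk] at hy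
  exact presentedMk_eq_zero cM pp hq hsym hdiag hoff hy

theorem range_presentedHom : (presentedHom cM pp hq hsym hdiag hoff).range =
    UIota K II cM q fun _ => -q ^ (-2 : ℤ) := by
  rw [UIota, Algebra.adjoin_range_eq_range_freeAlgebra_lift]
  ext y
  constructor
  · rintro ⟨z, rfl⟩
    obtain ⟨x, rfl⟩ : ∃ x, presentedMk cM q pp x = z := RingQuot.mkAlgHom_surjective K _ z
    exact ⟨x, (presentedHom_presentedMk cM pp hq hsym hdiag hoff x).symm⟩
  · rintro ⟨x, rfl⟩
    exact ⟨presentedMk cM q pp x, presentedHom_presentedMk cM pp hq hsym hdiag hoff x⟩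

end Presentation

theorem isGeneric_X : IsGeneric (RatFunc.X : RatFunc ℚ) where
  ne_zero := RatFunc.X_ne_zero
  pow_ne_one n hn h := by
    rw [← RatFunc.algebraMap_X, ← map_pow, ← map_one (algebraMap (Polynomial ℚ) (RatFunc ℚ))] at h
    have h' := congrArg Polynomial.natDegree (RatFunc.algebraMap_injective ℚ h)
    rw [Polynomial.natDegree_X_pow, Polynomial.natDegree_one] at h'
    omega

end ISerre

/-- **Statement 14** (Theorem 3.1 of [CLW18], Serre presentation): for any choice of
parities `p̄_i ∈ ℤ/2`, the split ıquantum group `Uı` with distinguished parameters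
`ς_i = -v⁻²` has a presentation with generators `B_i` and the ıSerre relations
`Σ_{n=0}^{1-c_{ij}} (-1)^n B_{i,p̄_i}^{(n)} B_j B_{i,c̄_{ij}+p̄_i}^{(1-c_{ij}-n)} = 0`
(`i ≠ j`), i.e. the algebra presented by these generators and relations is isomorphic to
`Uı` via `B_i ↦ B_i`. -/
theorem iSerre_presentation_of_split_iquantum_group
    (II : Type) (cM : II → II → ℤ)
    (hsym : ∀ i j, cM i j = cM j i) (hdiag : ∀ i, cM i i = 2)
    (hoff : ∀ i j, i ≠ j → cM i j ≤ 0)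
    (pp : II → ZMod 2) :
    ∃ e : IPresented (RatFunc ℚ) II cM RatFunc.X pp ≃ₐ[RatFunc ℚ]
        (UIota (RatFunc ℚ) II cM RatFunc.X (fun _ => -(RatFunc.X : RatFunc ℚ) ^ (-2 : ℤ))),
      ∀ i : II, e (RingQuot.mkAlgHom (RatFunc ℚ) _ (FreeAlgebra.ι (RatFunc ℚ) i)) =
        ⟨uB (RatFunc ℚ) II cM RatFunc.X (fun _ => -(RatFunc.X : RatFunc ℚ) ^ (-2 : ℤ)) i,
          Algebra.subset_adjoin ⟨i, rfl⟩⟩ := by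
  have hq := ISerre.isGeneric_X
  refine ⟨(AlgEquiv.ofInjective _
    (ISerre.presentedHom_injective cM pp hq hsym hdiag hoff)).trans
    (Subalgebra.equivOfEq _ _ (ISerre.range_presentedHom cM pp hq hsym hdiag hoff)), fun i => ?_⟩
  exact Subtype.ext ((ISerre.presentedHom_presentedMk cM pp hq hsym hdiag hoff _).trans
    (FreeAlgebra.lift_ι_apply _ _))

end
end

section
/- Let A be an essentially small abelian category, linear over a finite field, with finite Hom and Ext¹ sets. For any objects A, B, N, L of A, the number of morphisms s ∈ Hom_A(A,B) with Ker s ≅ N and Coker s ≅ L equals Σ_{[I]} F_{IN}^A · F_{LI}^B · a_I, where the sum runs over isomorphism classes [I] of objects of A, F_{MN}^L denotes the Hall number and a_I = |Aut_A(I)|. -/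
/-!
Formalization of statements from "ıquantum groups of split type via derived Hall algebras"
(Chen–Lu–Ruan).  We set up 1-periodic complexes, the 1-periodic derived category,
derived Hall algebras and ıHall algebras.
-/

open CategoryTheory Limits

noncomputable section

universe w w' w'' v u

/-- The type of isomorphism classes of objects of a category. -/
abbrev IsoCls (C : Type u) [Category.{v} C] : Type u :=
  Quotient (CategoryTheory.isIsomorphicSetoid C)

/-- The isomorphism class `[X]` of an object `X`. -/
abbrev mkIso {C : Type u} [Category.{v} C] (X : C) : IsoCls C :=
  Quotient.mk (CategoryTheory.isIsomorphicSetoid C) X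

section Counting

variable {A : Type u} [Category.{v} A] [Abelian A]

/-- `a_X`, the number of automorphisms of `X`. -/
def autCard (X : A) : ℕ := Nat.card (Aut X)

/-- The number of morphisms `X ⟶ Y`. -/
def homCard (X Y : A) : ℕ := Nat.card (X ⟶ Y)

/-- The Hall number `F_{MN}^L`: the number of subobjects `X ⊆ L` with `X ≅ N`
and `L/X ≅ M`. -/
def FHall (M N L : A) : ℕ :=
  Nat.card {X : Subobject L // Nonempty ((X : A) ≅ N) ∧ Nonempty ((cokernel X.arrow) ≅ M)}

/-- The number of short exact sequences `0 → N → L → M → 0` with fixed end terms and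
middle term.  By the Riedtmann–Peng formula, `|Ext¹(M,N)_L| / |Hom(M,N)|` equals
`sesCount M N L / a_L`. -/
def sesCount (M N L : A) : ℕ :=
  Nat.card {p : (N ⟶ L) × (L ⟶ M) // ∃ w : p.1 ≫ p.2 = 0, (ShortComplex.mk p.1 p.2 w).ShortExact}

end Counting

section ImageFactorization

variable {A : Type u} [Category.{v} A] [Abelian A]

theorem kernelSubobject_cokernel_π_comp_mono {X Z : A} (K : Subobject X)
    (m : cokernel K.arrow ⟶ Z) [Mono m] :
    kernelSubobject (cokernel.π K.arrow ≫ m) = K := by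
  apply le_antisymm
  · have h : kernel.ι (cokernel.π K.arrow ≫ m) ≫ cokernel.π K.arrow = 0 := by
      rw [← cancel_mono m, Category.assoc, kernel.condition, zero_comp]
    exact Subobject.mk_le_of_comm (Abelian.monoLift K.arrow _ h)
      (Abelian.monoLift_comp K.arrow _ h)
  · exact le_kernelSubobject _ _ (by simp)

theorem imageSubobject_epi_comp_arrow {X Y : A} (J : Subobject Y) (p : X ⟶ (J : A)) [Epi p] :
    imageSubobject (p ≫ J.arrow) = J := by
  have := imageSubobject_comp_le_epi_of_epi p J.arrow
  have := isIso_of_mono_of_epi (Subobject.ofLE _ _ (imageSubobject_comp_le p J.arrow))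
  have h : imageSubobject (p ≫ J.arrow) = imageSubobject J.arrow :=
    le_antisymm (imageSubobject_comp_le _ _)
      (Subobject.le_of_comm (inv (Subobject.ofLE _ _ (imageSubobject_comp_le p J.arrow)))
        (by simp))
  rw [h, imageSubobject_mono, Subobject.mk_arrow]

/-- The canonical isomorphism from the coimage to the image, as subobjects. -/
theorem exists_iso_cokernel_kernelSubobject_arrow {X Y : A} (s : X ⟶ Y) :
    ∃ e : cokernel (kernelSubobject s).arrow ≅ (imageSubobject s : A),
      cokernel.π (kernelSubobject s).arrow ≫ e.hom ≫ (imageSubobject s).arrow = s := by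
  have w : (kernelSubobject s).arrow ≫ factorThruImageSubobject s = 0 := by
    rw [← cancel_mono (imageSubobject s).arrow]
    simp
  let d := cokernel.desc _ _ w
  have hd : cokernel.π _ ≫ d = factorThruImageSubobject s := cokernel.π_desc _ _ _
  have : Epi d := epi_of_epi_fac hd
  have : Mono d := by
    have hs : (ShortComplex.mk _ _ w).Exact := by
      rw [ShortComplex.exact_iff_kernel_ι_comp_cokernel_π_zero]
      have h : kernel.ι (factorThruImageSubobject s) ≫ s = 0 := by
        have := kernel.condition_assoc (factorThruImageSubobject s) (imageSubobject s).arrow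
        rwa [imageSubobject_arrow_comp, zero_comp] at this
      rw [← Subobject.factorThru_arrow _ _ (kernelSubobject_factors s _ h), Category.assoc,
        cokernel.condition, comp_zero]
    exact hs.mono_cokernelDesc
  have := isIso_of_mono_of_epi d
  exact ⟨asIso d, by rw [asIso_hom, reassoc_of% hd, imageSubobject_arrow_comp]⟩

/-- The morphism with prescribed kernel, image, and identification of both with `I`. -/
def homOfKernelImageAut {X Y N L I : A}
    (t : ({K : Subobject X // Nonempty ((K : A) ≅ N) ∧ Nonempty (cokernel K.arrow ≅ I)} ×
      {J : Subobject Y // Nonempty ((J : A) ≅ I) ∧ Nonempty (cokernel J.arrow ≅ L)}) × (I ≅ I)) :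
    X ⟶ Y :=
  cokernel.π t.1.1.1.arrow ≫ t.1.1.2.2.some.hom ≫ t.2.hom ≫ t.1.2.2.1.some.inv ≫ t.1.2.1.arrow

theorem card_hom_kernel_cokernel_image (X Y N L I : A) :
    Nat.card {s : X ⟶ Y // (Nonempty (kernel s ≅ N) ∧ Nonempty (cokernel s ≅ L)) ∧
      Nonempty ((imageSubobject s : A) ≅ I)} = FHall I N X * FHall L I Y * autCard I := by
  have hker (t) : kernelSubobject (homOfKernelImageAut (X := X) (Y := Y) (N := N) (L := L)
      (I := I) t) = t.1.1.1 := kernelSubobject_cokernel_π_comp_mono _ _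
  have him (t) : imageSubobject (homOfKernelImageAut (X := X) (Y := Y) (N := N) (L := L)
      (I := I) t) = t.1.2.1 := by
    have := imageSubobject_epi_comp_arrow t.1.2.1
      (cokernel.π t.1.1.1.arrow ≫ t.1.1.2.2.some.hom ≫ t.2.hom ≫ t.1.2.2.1.some.inv)
    simpa only [homOfKernelImageAut, Category.assoc] using this
  have hcoker {s : X ⟶ Y} : Nonempty (cokernel (imageSubobject s).arrow ≅ cokernel s) :=
    ⟨(cokernelEpiComp (factorThruImageSubobject s) (imageSubobject s).arrow).symm ≪≫
      cokernelIsoOfEq (imageSubobject_arrow_comp s)⟩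
  rw [FHall, FHall, autCard, Aut, ← Nat.card_prod, ← Nat.card_prod]
  symm
  refine Nat.card_eq_of_bijective (fun t => ⟨homOfKernelImageAut t, ⟨⟨?_, ?_⟩, ?_⟩⟩) ⟨?_, ?_⟩
  · refine ⟨(kernelSubobjectIso _).symm ≪≫ Subobject.isoOfEq _ _ (hker t) ≪≫ t.1.1.2.1.some⟩
  · have e := hcoker (s := homOfKernelImageAut t)
    rw [him] at e
    exact ⟨e.some.symm ≪≫ t.1.2.2.2.some⟩
  · exact ⟨Subobject.isoOfEq _ _ (him t) ≪≫ t.1.2.2.1.some⟩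
  · intro t t' h
    have h : homOfKernelImageAut t = homOfKernelImageAut t' := congrArg Subtype.val h
    have hK := hker t'
    have hJ := him t'
    rw [← h] at hK hJ
    rw [hker] at hK
    rw [him] at hJ
    obtain ⟨⟨K, J⟩, φ⟩ := t
    obtain ⟨⟨K', J'⟩, φ'⟩ := t'
    obtain rfl := Subtype.ext hK
    obtain rfl := Subtype.ext hJ
    have : φ = φ' := by
      apply Iso.ext
      simpa [homOfKernelImageAut, cancel_epi, cancel_mono, ← Category.assoc] using h
    rw [this]
  · rintro ⟨s, ⟨⟨⟨eN⟩, ⟨eL⟩⟩, ⟨eI⟩⟩⟩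
    obtain ⟨e, he⟩ := exists_iso_cokernel_kernelSubobject_arrow s
    let K : {K : Subobject X // Nonempty ((K : A) ≅ N) ∧ Nonempty (cokernel K.arrow ≅ I)} :=
      ⟨kernelSubobject s, ⟨kernelSubobjectIso s ≪≫ eN⟩, ⟨e ≪≫ eI⟩⟩
    let J : {J : Subobject Y // Nonempty ((J : A) ≅ I) ∧ Nonempty (cokernel J.arrow ≅ L)} :=
      ⟨imageSubobject s, ⟨eI⟩, ⟨hcoker.some ≪≫ eL⟩⟩
    refine ⟨⟨⟨K, J⟩, K.2.2.some.symm ≪≫ e ≪≫ J.2.1.some⟩, Subtype.ext ?_⟩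
    simpa [homOfKernelImageAut, K, J] using he

end ImageFactorization

theorem Nat.card_eq_finsum_card_fiber {α β : Type*} [Finite α] (f : α → β) :
    Nat.card α = ∑ᶠ b, Nat.card {a // f a = b} := by
  classical
  have := Fintype.ofFinite α
  rw [finsum_eq_sum_of_support_subset (s := Finset.univ.image f)]
  · rw [Nat.card_eq_fintype_card, ← Finset.card_univ,
      Finset.card_eq_sum_card_fiberwise (t := Finset.univ.image f) (f := f) (by intro; simp)]
    refine Finset.sum_congr rfl fun b _ => ?_
    rw [Nat.card_eq_fintype_card, Fintype.card_subtype]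
  · intro b hb
    obtain ⟨⟨a, rfl⟩⟩ := (Nat.card_ne_zero.1 hb).1
    simp

/-- **Statement 16**: the number of morphisms `s : X ⟶ Y` with `Ker s ≅ N` and
`Coker s ≅ L` equals `Σ_{[I]} F_{IN}^X ⬝ F_{LI}^Y ⬝ a_I`. -/
theorem hom_count_by_kernel_and_cokernel
    (k : Type) [Field k] [Fintype k]
    {A : Type u} [Category.{v} A] [Abelian A] [Linear k A] [EssentiallySmall.{v} A]
    [∀ X Y : A, Finite (X ⟶ Y)]
    (X Y N L : A) :
    Nat.card {s : X ⟶ Y // Nonempty (kernel s ≅ N) ∧ Nonempty (cokernel s ≅ L)} =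
      ∑ᶠ i : IsoCls A, FHall i.out N X * FHall L i.out Y * autCard i.out := by
  rw [Nat.card_eq_finsum_card_fiber fun s : {s : X ⟶ Y // Nonempty (kernel s ≅ N) ∧
    Nonempty (cokernel s ≅ L)} => mkIso (imageSubobject s.1 : A)]
  refine finsum_congr fun i => ?_
  rw [← card_hom_kernel_cokernel_image]
  refine Nat.card_congr ((Equiv.subtypeSubtypeEquivSubtypeInter _ fun s : X ⟶ Y =>
    mkIso (imageSubobject s : A) = i).trans (Equiv.subtypeEquivRight fun s => ?_))
  refine and_congr_right fun _ => ?_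
  conv_lhs => rw [← i.out_eq]
  exact Quotient.eq

end
end
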